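/- arXiv:1812.10512 — 7 statements merged into one kernel-verified Lean document; each statement's English description precedes it below -/
import Mathlib

section
/- Let λ > 0 and λ₁, μ, μ₁ ∈ ℝ with α = λ₁/λ ≠ -1. Assume c₁ > 0, c₂ > 0, δ > 1 and σ > 1 (i.e., (α,δ,σ) ∈ U₁(+,+)). Then the discrete spectrum s_d(H) consists of exactly three distinct real numbers ν₁, ν₂, ν₃, where ν₃ = κ and 4λ < ν₁ < 2λ(min{σ, (δ²+1)/(2δ)} + 1) ≤ 2λ(max{σ, (δ²+1)/(2δ)} + 1) < ν₂. -/
/-- The Hamiltonian `H = H₀ + H₁` acting on complex sequences `f : ℤ → ℂ`. -/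
noncomputable def Hop (lam lam1 mu mu1 : ℝ) (f : ℤ → ℂ) : ℤ → ℂ := fun n =>
  if n = 0 then -((lam : ℂ) + (lam1 : ℂ)) * (f 1 - 2 * f 0 + f (-1)) + (mu : ℂ) * f 0
  else if n = 1 then -(lam : ℂ) * (f 2 - 2 * f 1 + f 0) - (lam1 : ℂ) * f 0 + (mu1 : ℂ) * f 1
  else if n = -1 then
    -(lam : ℂ) * (f 0 - 2 * f (-1) + f (-2)) - (lam1 : ℂ) * f 0 + (mu1 : ℂ) * f (-1)
  else -(lam : ℂ) * (f (n + 1) - 2 * f n + f (n - 1))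

/-- `ν` is an eigenvalue of `H`: there is a nonzero square-summable `f` with `Hf = νf`. -/
noncomputable def IsEigenvalue (lam lam1 mu mu1 ν : ℝ) : Prop :=
  ∃ f : ℤ → ℂ, f ≠ 0 ∧ Summable (fun n : ℤ => ‖f n‖ ^ 2) ∧
    ∀ n : ℤ, Hop lam lam1 mu mu1 f n = (ν : ℂ) * f n

/-- The discrete spectrum `s_d(H)`: real eigenvalues outside `[0, 4λ]`. -/
noncomputable def discSpec (lam lam1 mu mu1 : ℝ) : Set ℝ :=
  {ν : ℝ | IsEigenvalue lam lam1 mu mu1 ν ∧ ν ∉ Set.Icc 0 (4 * lam)}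

open Filter Topology

/-- A null sequence solving the constant-coefficient recurrence with characteristic roots
`-y` and `-y⁻¹`, where `1 < |y|`, is geometric with ratio `-y⁻¹`. -/
lemma geometric_of_recurrence {y : ℝ} (hy : 1 < |y|) {a : ℕ → ℂ} (ha : Tendsto a atTop (𝓝 0))
    (hrec : ∀ n, a (n + 2) + ((y : ℂ) + (y : ℂ)⁻¹) * a (n + 1) + a n = 0) (n : ℕ) :
    a n = (-(y : ℂ)⁻¹) ^ n * a 0 := by
  have hy0 : (y : ℂ) ≠ 0 := by
    norm_cast
    rintro rfl
    norm_num at hy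
  set g : ℕ → ℂ := fun n => a (n + 1) + (y : ℂ)⁻¹ * a n with hg
  have hstep : ∀ n, g (n + 1) = -(y : ℂ) * g n := by
    intro n
    have := hrec n
    simp only [hg]
    field_simp at this ⊢
    linear_combination this
  have hpow : ∀ m k, g (k + m) = (-(y : ℂ)) ^ m * g k := by
    intro m k
    induction m with
    | zero => simp
    | succ m ih => rw [← add_assoc, hstep, ih]; ring
  have hlim : Tendsto g atTop (𝓝 0) := by
    simpa using (ha.comp (tendsto_add_atTop_nat 1)).add (ha.const_mul (y : ℂ)⁻¹)
  have hzero : ∀ k, g k = 0 := by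
    intro k
    have h1 : Tendsto (fun m => ‖g (k + m)‖) atTop (𝓝 0) := by
      have := (hlim.comp (tendsto_add_atTop_nat k)).norm
      simpa [Function.comp_def, add_comm] using this
    have h2 : ‖g k‖ ≤ 0 := by
      refine ge_of_tendsto h1 (Eventually.of_forall fun m => ?_)
      rw [hpow m k, norm_mul, norm_pow, norm_neg, Complex.norm_real, Real.norm_eq_abs]
      exact le_mul_of_one_le_left (norm_nonneg _) (one_le_pow₀ hy.le)
    exact norm_le_zero_iff.mp h2
  induction n with
  | zero => simp
  | succ n ih =>
    have := hzero n
    simp only [hg] at this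
    rw [pow_succ']
    linear_combination this - (y : ℂ)⁻¹ * ih

section Eigenvalue

variable {lam al de si y : ℝ}

/-- The parameters are `lam1 = al * lam`, `mu1 = de * lam` and `mu = 2 * (si - al) * lam`. -/
lemma isEigenvalue_of_matching (hy : 1 < |y|) {a b c : ℂ} (hab : a ≠ 0)
    (h1 : ((de : ℂ) - y) * a = (1 + al) * c * -y) (h2 : ((de : ℂ) - y) * b = (1 + al) * c * -y)
    (h0 : (2 * (si : ℂ) - y - (y : ℂ)⁻¹) * c = (1 + al) * (-(y : ℂ)⁻¹ * (a + b))) :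
    IsEigenvalue lam (al * lam) (2 * (si - al) * lam) (de * lam) (lam * (2 + y + y⁻¹)) := by
  have hy0 : (y : ℂ) ≠ 0 := by
    norm_cast
    rintro rfl
    norm_num at hy
  set r : ℂ := -(y : ℂ)⁻¹ with hr
  have hr0 : r ≠ 0 := neg_ne_zero.mpr (inv_ne_zero hy0)
  have hr1 : ‖r‖ < 1 := by
    rw [hr, norm_neg, norm_inv, Complex.norm_real, Real.norm_eq_abs]
    exact inv_lt_one_of_one_lt₀ hy
  have hsum : ∀ z : ℂ, Summable fun n : ℕ => ‖z * r ^ n‖ ^ 2 := by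
    intro z
    have : Summable fun n : ℕ => ‖z‖ ^ 2 * (‖r‖ ^ 2) ^ n :=
      (summable_geometric_of_lt_one (by positivity)
        (pow_lt_one₀ (norm_nonneg r) hr1 two_ne_zero)).mul_left _
    refine this.congr fun n => ?_
    rw [norm_mul, norm_pow, mul_pow, ← pow_mul, ← pow_mul, mul_comm 2 n]
  refine ⟨fun n => if n = 0 then c else (if 0 < n then a else b) * r ^ n.natAbs, ?_, ?_, ?_⟩
  · intro h
    have := congrFun h 1
    simp [hab, hr0] at this
  · refine Summable.of_nat_of_neg ?_ ?_
    · rw [← summable_nat_add_iff 1]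
      refine ((summable_nat_add_iff 1).mpr (hsum a)).congr fun n => ?_
      have e1 : ((n + 1 : ℕ) : ℤ) ≠ 0 := by omega
      have e2 : 0 < ((n + 1 : ℕ) : ℤ) := by omega
      simp only [if_neg e1, if_pos e2, Int.natAbs_natCast]
    · rw [← summable_nat_add_iff 1]
      refine ((summable_nat_add_iff 1).mpr (hsum b)).congr fun n => ?_
      have e1 : -((n + 1 : ℕ) : ℤ) ≠ 0 := by omega
      have e2 : ¬ 0 < -((n + 1 : ℕ) : ℤ) := by omega
      simp only [if_neg e1, if_neg e2, Int.natAbs_neg, Int.natAbs_natCast]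
  · have hry : r * y = -1 := by rw [hr]; field_simp
    have hyi : (y : ℂ)⁻¹ = -r := by rw [hr]; ring
    rw [hyi] at h0
    intro n
    have hfar : ∀ (k : ℕ) (z : ℂ),
        -(lam : ℂ) * (z * r ^ (k + 3) - 2 * (z * r ^ (k + 2)) + z * r ^ (k + 1)) =
          (lam * (2 + y + -r)) * (z * r ^ (k + 2)) := by
      intro k z
      linear_combination -(lam : ℂ) * z * r ^ (k + 1) * hry
    obtain rfl | rfl | rfl | ⟨k, rfl⟩ | ⟨k, rfl⟩ :
        n = 0 ∨ n = 1 ∨ n = -1 ∨ (∃ k : ℕ, n = k + 2) ∨ ∃ k : ℕ, n = -((k : ℤ) + 2) := by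
      by_cases hn : 2 ≤ n
      · exact .inr (.inr (.inr (.inl ⟨(n - 2).toNat, by omega⟩)))
      · by_cases hn' : n ≤ -2
        · exact .inr (.inr (.inr (.inr ⟨(-n - 2).toNat, by omega⟩)))
        · omega
    · simp [Hop]
      rw [hyi]
      linear_combination (lam : ℂ) * h0
    · simp [Hop]
      rw [hyi]
      linear_combination (lam : ℂ) * r * h1 - lam * (1 + al) * c * hry
    · simp [Hop]
      rw [hyi]
      linear_combination (lam : ℂ) * r * h2 - lam * (1 + al) * c * hry
    · have e0 : ((k : ℤ) + 2) ≠ 0 := by omega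
      have e1 : ((k : ℤ) + 2) ≠ 1 := by omega
      have e2 : ((k : ℤ) + 2) ≠ -1 := by omega
      have e3 : ((k : ℤ) + 2 + 1) ≠ 0 := by omega
      have e4 : ((k : ℤ) + 2 - 1) ≠ 0 := by omega
      have p0 : 0 < ((k : ℤ) + 2) := by omega
      have p1 : 0 < ((k : ℤ) + 2 + 1) := by omega
      have p2 : 0 < ((k : ℤ) + 2 - 1) := by omega
      have n0 : ((k : ℤ) + 2).natAbs = k + 2 := by omega
      have n1 : ((k : ℤ) + 2 + 1).natAbs = k + 3 := by omega
      have n2 : ((k : ℤ) + 2 - 1).natAbs = k + 1 := by omega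
      simp only [Hop, if_neg e0, if_neg e1, if_neg e2, if_neg e3, if_neg e4, if_pos p0, if_pos p1,
        if_pos p2, n0, n1, n2]
      push_cast
      rw [hyi]
      exact hfar k a
    · have e0 : -((k : ℤ) + 2) ≠ 0 := by omega
      have e1 : -((k : ℤ) + 2) ≠ 1 := by omega
      have e2 : -((k : ℤ) + 2) ≠ -1 := by omega
      have e3 : (-((k : ℤ) + 2) + 1) ≠ 0 := by omega
      have e4 : (-((k : ℤ) + 2) - 1) ≠ 0 := by omega
      have p0 : ¬ 0 < -((k : ℤ) + 2) := by omega
      have p1 : ¬ 0 < (-((k : ℤ) + 2) + 1) := by omega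
      have p2 : ¬ 0 < (-((k : ℤ) + 2) - 1) := by omega
      have n0 : (-((k : ℤ) + 2)).natAbs = k + 2 := by omega
      have n1 : (-((k : ℤ) + 2) + 1).natAbs = k + 1 := by omega
      have n2 : (-((k : ℤ) + 2) - 1).natAbs = k + 3 := by omega
      simp only [Hop, if_neg e0, if_neg e1, if_neg e2, if_neg e3, if_neg e4, if_neg p0, if_neg p1,
        if_neg p2, n0, n1, n2]
      push_cast
      rw [hyi]
      linear_combination hfar k b

lemma eq_or_secular_of_isEigenvalue (hlam : 0 < lam) (hy : 1 < |y|)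
    (h : IsEigenvalue lam (al * lam) (2 * (si - al) * lam) (de * lam) (lam * (2 + y + y⁻¹))) :
    y = de ∨ (y + y⁻¹ - 2 * si) * (y - de) = 2 * (al + 1) ^ 2 := by
  obtain ⟨f, hf, hsum, heq⟩ := h
  have hl : (lam : ℂ) ≠ 0 := by exact_mod_cast hlam.ne'
  have hlim : Tendsto f cofinite (𝓝 0) := by
    rw [tendsto_zero_iff_norm_tendsto_zero]
    have := hsum.tendsto_cofinite_zero.sqrt
    simpa [Real.sqrt_sq] using this
  have hfar : ∀ n : ℤ, n ≠ 0 → n ≠ 1 → n ≠ -1 →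
      f (n + 1) + ((y : ℂ) + (y : ℂ)⁻¹) * f n + f (n - 1) = 0 := by
    intro n a b c
    have := heq n
    simp only [Hop, if_neg a, if_neg b, if_neg c] at this
    push_cast at this
    apply mul_left_cancel₀ hl
    linear_combination -this
  have hpos := geometric_of_recurrence hy (a := fun n : ℕ => f (n + 1))
    (hlim.comp (Function.Injective.tendsto_cofinite (f := fun n : ℕ => (n : ℤ) + 1)
      (fun a b h => by simpa using h) |>.mono_left Nat.cofinite_eq_atTop.ge))
    (fun n => by
      have := hfar (n + 2) (by omega) (by omega) (by omega)
      push_cast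
      convert this using 3 <;> ring_nf)
  have hneg := geometric_of_recurrence hy (a := fun n : ℕ => f (-((n : ℤ) + 1)))
    (hlim.comp (Function.Injective.tendsto_cofinite (f := fun n : ℕ => -((n : ℤ) + 1))
      (fun a b h => by simpa using h) |>.mono_left Nat.cofinite_eq_atTop.ge))
    (fun n => by
      have := hfar (-((n : ℤ) + 2)) (by omega) (by omega) (by omega)
      have e1 : -((n : ℤ) + 2) + 1 = -((n : ℤ) + 1) := by ring
      have e2 : -((n : ℤ) + 2) - 1 = -(((n + 2 : ℕ) : ℤ) + 1) := by push_cast; ring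
      have e3 : -((n : ℤ) + 2) = -(((n + 1 : ℕ) : ℤ) + 1) := by push_cast; ring
      rw [e1, e2, e3] at this
      linear_combination this)
  have hzero : ¬ (f 0 = 0 ∧ f 1 = 0 ∧ f (-1) = 0) := by
    rintro ⟨z0, z1, z2⟩
    refine hf (funext fun n => ?_)
    obtain rfl | ⟨k, rfl⟩ | ⟨k, rfl⟩ :
        n = 0 ∨ (∃ k : ℕ, n = k + 1) ∨ ∃ k : ℕ, n = -((k : ℤ) + 1) := by
      by_cases hn : 1 ≤ n
      · exact .inr (.inl ⟨(n - 1).toNat, by omega⟩)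
      · by_cases hn' : n ≤ -1
        · exact .inr (.inr ⟨(-n - 1).toNat, by omega⟩)
        · omega
    · exact z0
    · simpa [z1] using hpos k
    · simpa [z2] using hneg k
  have f2 : f 2 = -(y : ℂ)⁻¹ * f 1 := by simpa using hpos 1
  have f2' : f (-2) = -(y : ℂ)⁻¹ * f (-1) := by simpa using hneg 1
  have q0 := heq 0
  have q1 := heq 1
  have q2 := heq (-1)
  simp [Hop] at q0 q1 q2
  have r0 : (2 * (si : ℂ) - y - (y : ℂ)⁻¹) * f 0 = (1 + al) * (f 1 + f (-1)) := by
    apply mul_left_cancel₀ hl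
    linear_combination q0
  have r1 : ((de : ℂ) - y) * f 1 = (1 + al) * f 0 := by
    apply mul_left_cancel₀ hl
    linear_combination q1 + lam * f2
  have r2 : ((de : ℂ) - y) * f (-1) = (1 + al) * f 0 := by
    apply mul_left_cancel₀ hl
    linear_combination q2 + lam * f2'
  refine or_iff_not_imp_left.mpr fun hne => ?_
  have hd : (de : ℂ) - y ≠ 0 := by
    rw [sub_ne_zero]
    exact_mod_cast Ne.symm hne
  have hf0 : f 0 ≠ 0 := by
    intro z0
    rw [z0, mul_zero] at r1 r2
    exact hzero ⟨z0, (mul_eq_zero.mp r1).resolve_left hd, (mul_eq_zero.mp r2).resolve_left hd⟩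
  have : ((y : ℂ) + (y : ℂ)⁻¹ - 2 * si) * (y - de) = 2 * (al + 1) ^ 2 := by
    apply mul_right_cancel₀ hf0
    linear_combination ((de : ℂ) - y) * r0 + (1 + al) * (r1 + r2)
  exact_mod_cast this

lemma isEigenvalue_iff (hlam : 0 < lam) (hal : al ≠ -1) (hy : 1 < |y|) :
    IsEigenvalue lam (al * lam) (2 * (si - al) * lam) (de * lam) (lam * (2 + y + y⁻¹)) ↔
      y = de ∨ (y + y⁻¹ - 2 * si) * (y - de) = 2 * (al + 1) ^ 2 := by
  refine ⟨eq_or_secular_of_isEigenvalue hlam hy, ?_⟩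
  rintro (rfl | h)
  · exact isEigenvalue_of_matching hy (a := 1) (b := -1) (c := 0) one_ne_zero
      (by simp) (by simp) (by simp)
  · have hy0 : (y : ℂ) ≠ 0 := by
      norm_cast
      rintro rfl
      norm_num at hy
    have ha : (1 + al : ℂ) ≠ 0 := by
      norm_cast
      intro h
      exact hal (by linarith)
    have hC : ((y : ℂ) + (y : ℂ)⁻¹ - 2 * si) * (y - de) = 2 * (al + 1) ^ 2 := by exact_mod_cast h
    refine isEigenvalue_of_matching hy (a := 1 + al) (b := 1 + al)
      (c := -(y : ℂ)⁻¹ * (de - y)) ha ?_ ?_ ?_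
    · field_simp
    · field_simp
    · linear_combination -(y : ℂ)⁻¹ * hC

end Eigenvalue

lemma add_inv_lt_add_inv {x y : ℝ} (hx : 1 < x) (hxy : x < y) : x + x⁻¹ < y + y⁻¹ := by
  have hy : 0 < y := by linarith
  have hx0 : 0 < x := by linarith
  have h : y + y⁻¹ - (x + x⁻¹) = (y - x) * (x * y - 1) / (x * y) := by field_simp; ring
  have : 0 < (y - x) * (x * y - 1) / (x * y) :=
    div_pos (mul_pos (by linarith) (by nlinarith)) (mul_pos hx0 hy)
  linarith

lemma exists_add_inv_eq_of_two_lt {x : ℝ} (hx : 2 < x) : ∃ y, 1 < y ∧ y + y⁻¹ = x := by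
  have hs := Real.sq_sqrt (show 0 ≤ x ^ 2 - 4 by nlinarith)
  have hs0 := Real.sqrt_nonneg (x ^ 2 - 4)
  set s := √(x ^ 2 - 4)
  refine ⟨(x + s) / 2, by linarith, ?_⟩
  have : x + s ≠ 0 := by linarith
  field_simp
  linarith

lemma exists_add_inv_eq {x : ℝ} (hx : 2 < |x|) : ∃ y, 1 < |y| ∧ y + y⁻¹ = x := by
  rcases lt_abs.mp hx with h | h
  · obtain ⟨y, hy, e⟩ := exists_add_inv_eq_of_two_lt h
    exact ⟨y, hy.trans_le (le_abs_self y), e⟩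
  · obtain ⟨y, hy, e⟩ := exists_add_inv_eq_of_two_lt h
    refine ⟨-y, by rw [abs_neg]; exact hy.trans_le (le_abs_self y), ?_⟩
    rw [inv_neg]
    linarith

/-- Existence and uniqueness of the roots of the secular equation on each side of `de`. -/
lemma secular_roots {si de A : ℝ} (hA : 0 < A) (hde : 1 < de) (hsi : 1 < si)
    (h1 : A < (de - 1) * (si - 1)) :
    ∃ y₁ y₂ : ℝ, 1 < y₁ ∧ y₁ < de ∧ de < y₂ ∧ y₁ + y₁⁻¹ < 2 * si ∧ 2 * si < y₂ + y₂⁻¹ ∧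
      ∀ y, 1 < |y| → ((y + y⁻¹ - 2 * si) * (y - de) = 2 * A ↔ y = y₁ ∨ y = y₂) := by
  set F : ℝ → ℝ := fun y => (y + y⁻¹ - 2 * si) * (y - de) with hF
  have hcont : ∀ a b : ℝ, 1 ≤ a → ContinuousOn F (Set.Icc a b) := by
    intro a b ha
    refine ((continuousOn_id.add (continuousOn_id.inv₀ fun x hx => ?_)).sub
      continuousOn_const).mul (continuousOn_id.sub continuousOn_const)
    have := hx.1
    simp only [id]
    linarith
  obtain ⟨y₁, ⟨ha, hb⟩, e₁⟩ := intermediate_value_Ioo' hde.le (hcont 1 de le_rfl)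
    (show 2 * A ∈ Set.Ioo (F de) (F 1) from ⟨by simp [hF, hA], by
      simp only [hF]
      norm_num
      nlinarith⟩)
  set M := de + 2 * si + 2 * A + 1 with hM
  have hM0 : 0 < M⁻¹ := inv_pos.mpr (by linarith)
  obtain ⟨y₂, ⟨hc, -⟩, e₂⟩ := intermediate_value_Ioo (show de ≤ M by linarith)
    (hcont de M hde.le)
    (show 2 * A ∈ Set.Ioo (F de) (F M) from ⟨by simp [hF, hA], by
      have u : 1 ≤ M + M⁻¹ - 2 * si := by linarith
      have v : 2 * A < M - de := by linarith
      simp only [hF]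
      nlinarith⟩)
  have sign_lt : ∀ y, F y = 2 * A → y < de → y + y⁻¹ < 2 * si := by
    intro y e hy
    simp only [hF] at e
    by_contra! h
    nlinarith
  have sign_gt : ∀ y, F y = 2 * A → de < y → 2 * si < y + y⁻¹ := by
    intro y e hy
    simp only [hF] at e
    by_contra! h
    nlinarith
  have anti : ∀ y z, 1 < y → y < z → z < de → F y = 2 * A → F z ≠ 2 * A := by
    intro y z hy hyz hz ey ez
    have := add_inv_lt_add_inv hy hyz
    have := sign_lt z ez hz
    simp only [hF] at ey ez
    nlinarith
  have mono : ∀ y z, de < y → y < z → F y = 2 * A → F z ≠ 2 * A := by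
    intro y z hy hyz ey ez
    have := add_inv_lt_add_inv (hde.trans hy) hyz
    have := sign_gt y ey hy
    simp only [hF] at ey ez
    nlinarith
  refine ⟨y₁, y₂, ha, hb, hc, sign_lt _ e₁ hb, sign_gt _ e₂ hc, fun y hy => ⟨fun e => ?_, ?_⟩⟩
  · rcases lt_abs.mp hy with hy | hy
    · rcases lt_trichotomy y de with h | h | h
      · left
        rcases lt_trichotomy y y₁ with k | k | k
        · exact absurd e₁ (anti _ _ hy k hb e)
        · exact k
        · exact absurd e (anti _ _ ha k h e₁)
      · rw [h, sub_self, mul_zero] at e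
        linarith
      · right
        rcases lt_trichotomy y y₂ with k | k | k
        · exact absurd e₂ (mono _ _ h k e)
        · exact k
        · exact absurd e (mono _ _ hc k e₂)
    · exfalso
      have h3 : y + y⁻¹ + 2 < 0 := by
        have hne : y ≠ 0 := by linarith
        have : y + y⁻¹ + 2 = (y + 1) ^ 2 / y := by field_simp; ring
        rw [this]
        exact div_neg_of_pos_of_neg (by nlinarith) (by linarith)
      nlinarith
  · rintro (rfl | rfl)
    · exact e₁
    · exact e₂

/-- Theorem 1 a): in the region `U₁(+,+)` the discrete spectrum consists of exactly three
distinct eigenvalues `ν₁, ν₂, ν₃` with `ν₃ = κ` and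
`4λ < ν₁ < 2λ(min{σ, (δ²+1)/(2δ)} + 1) ≤ 2λ(max{σ, (δ²+1)/(2δ)} + 1) < ν₂`. -/
theorem stmt0 (lam lam1 mu mu1 al de si c1 c2 kap : ℝ)
    (hlam : 0 < lam)
    (hal : al = lam1 / lam) (hde : de = mu1 / lam) (hsi : si = (2 * lam1 + mu) / (2 * lam))
    (hc1 : c1 = (de - 1) * (si - 1) - (al + 1) ^ 2)
    (hc2 : c2 = (de + 1) * (si + 1) - (al + 1) ^ 2)
    (hkap : kap = (mu1 + lam) ^ 2 / mu1)
    (halne : al ≠ -1)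
    (h1 : 0 < c1) (h2 : 0 < c2) (h3 : 1 < de) (h4 : 1 < si) :
    ∃ ν1 ν2 ν3 : ℝ,
      ν3 = kap ∧
      4 * lam < ν1 ∧
      ν1 < 2 * lam * (min si ((de ^ 2 + 1) / (2 * de)) + 1) ∧
      2 * lam * (min si ((de ^ 2 + 1) / (2 * de)) + 1) ≤
        2 * lam * (max si ((de ^ 2 + 1) / (2 * de)) + 1) ∧
      2 * lam * (max si ((de ^ 2 + 1) / (2 * de)) + 1) < ν2 ∧
      ν1 ≠ ν2 ∧ ν1 ≠ ν3 ∧ ν2 ≠ ν3 ∧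
      discSpec lam lam1 mu mu1 = {ν1, ν2, ν3} := by
  have hal' : lam1 = al * lam := by rw [hal]; field_simp
  have hde' : mu1 = de * lam := by rw [hde]; field_simp
  have hsi' : mu = 2 * (si - al) * lam := by rw [hsi, hal]; field_simp; ring
  have hA : 0 < (al + 1) ^ 2 := by
    have : al + 1 ≠ 0 := fun h => halne (by linarith)
    positivity
  obtain ⟨y₁, y₂, ha, hb, hc, hs₁, hs₂, hroots⟩ :=
    secular_roots hA h3 h4 (by linarith)
  have hde0 : 0 < de := by linarith
  have hmid : (de ^ 2 + 1) / (2 * de) = (de + de⁻¹) / 2 := by field_simp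
  have hkap' : kap = lam * (2 + de + de⁻¹) := by
    rw [hkap, hde']
    field_simp
    ring
  have hm₁ := add_inv_lt_add_inv ha hb
  have hm₂ := add_inv_lt_add_inv h3 hc
  have habs : ∀ {y : ℝ}, 1 < y → 1 < |y| := fun h => h.trans_le (le_abs_self _)
  have hout : ∀ {y : ℝ}, 1 < y → 4 * lam < lam * (2 + y + y⁻¹) := by
    intro y hy
    have hy0 : 0 < y := by linarith
    have : y + y⁻¹ - 2 = (y - 1) ^ 2 / y := by field_simp; ring
    have : 0 < y + y⁻¹ - 2 := by
      rw [this]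
      exact div_pos (by nlinarith) hy0
    nlinarith
  have hlt₁ : lam * (2 + y₁ + y₁⁻¹) < lam * (2 + de + de⁻¹) :=
    mul_lt_mul_of_pos_left (by linarith) hlam
  have hlt₂ : lam * (2 + de + de⁻¹) < lam * (2 + y₂ + y₂⁻¹) :=
    mul_lt_mul_of_pos_left (by linarith) hlam
  refine ⟨lam * (2 + y₁ + y₁⁻¹), lam * (2 + y₂ + y₂⁻¹), kap, rfl, hout ha, ?_, ?_, ?_,
    (hlt₁.trans hlt₂).ne, hkap' ▸ hlt₁.ne, hkap' ▸ hlt₂.ne', ?_⟩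
  · rw [hmid]
    have : (y₁ + y₁⁻¹) / 2 < min si ((de + de⁻¹) / 2) := lt_min (by linarith) (by linarith)
    nlinarith
  · gcongr
    exact min_le_max
  · rw [hmid]
    have : max si ((de + de⁻¹) / 2) < (y₂ + y₂⁻¹) / 2 := max_lt (by linarith) (by linarith)
    nlinarith
  · rw [hkap', hal', hde', hsi']
    have hmem : ∀ {y : ℝ}, 1 < y →
        (y = de ∨ (y + y⁻¹ - 2 * si) * (y - de) = 2 * (al + 1) ^ 2) →
        lam * (2 + y + y⁻¹) ∈ discSpec lam (al * lam) (2 * (si - al) * lam) (de * lam) :=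
      fun hy h => ⟨(isEigenvalue_iff hlam halne (habs hy)).mpr h, fun k => (hout hy).not_ge k.2⟩
    ext ν
    simp only [Set.mem_insert_iff, Set.mem_singleton_iff]
    constructor
    · rintro ⟨hν, hν'⟩
      have hx : 2 < |ν / lam - 2| := by
        rw [lt_abs]
        by_contra! h
        have k1 : ν / lam ≤ 4 := by linarith
        have k2 : 0 ≤ ν / lam := by linarith
        rw [div_le_iff₀ hlam] at k1
        rw [le_div_iff₀ hlam] at k2
        exact hν' ⟨by linarith, k1⟩
      obtain ⟨y, hy, e⟩ := exists_add_inv_eq hx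
      have hνy : ν = lam * (2 + y + y⁻¹) := by
        rw [add_assoc, e]
        field_simp
        ring
      rw [hνy, isEigenvalue_iff hlam halne hy, hroots y hy] at hν
      rcases hν with rfl | rfl | rfl <;> simp [hνy]
    · rintro (rfl | rfl | rfl)
      · exact hmem ha (.inr ((hroots _ (habs ha)).mpr (.inl rfl)))
      · exact hmem (h3.trans hc) (.inr ((hroots _ (habs (h3.trans hc))).mpr (.inr rfl)))
      · exact hmem h3 (.inl rfl)
end

section
/- Let λ > 0 and λ₁, μ, μ₁ ∈ ℝ with α = λ₁/λ ≠ -1. Assume c₁ ≥ 0, c₂ ≥ 0, |δ| ≤ 1 and |σ| ≤ 1 (i.e., (α,δ,σ) ∈ U₀(+,+)). Then the discrete spectrum s_d(H) is empty: no real ν ∉ [0, 4λ] is an eigenvalue of H. -/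
/-- A null sequence solving `u (n + 2) + u n = (t + t⁻¹) u (n + 1)` with `1 < |t|` is geometric
of ratio `t⁻¹`. -/
theorem geometric_of_recurrence_of_tendsto_zero {t : ℝ} (ht : 1 < |t|) {u : ℕ → ℂ}
    (hu : ∀ n, u (n + 2) + u n = ((t : ℂ) + (t : ℂ)⁻¹) * u (n + 1))
    (hlim : Filter.Tendsto u Filter.atTop (nhds 0)) (n : ℕ) :
    u (n + 1) = (t : ℂ)⁻¹ * u n := by
  have ht0 : (t : ℂ) ≠ 0 := by
    rintro h
    norm_num [Complex.ofReal_eq_zero.mp h] at ht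
  set w : ℕ → ℂ := fun n => u (n + 1) - (t : ℂ)⁻¹ * u n with hw
  have hstep (n : ℕ) : w (n + 1) = t * w n := by
    simp only [hw]
    linear_combination hu n + u n * mul_inv_cancel₀ ht0
  have hgrow (n k : ℕ) : ‖w n‖ ≤ ‖w (n + k)‖ := by
    induction k with
    | zero => rfl
    | succ k ih =>
      rw [← add_assoc, hstep, norm_mul, Complex.norm_real, Real.norm_eq_abs]
      nlinarith [norm_nonneg (w (n + k))]
  have hwlim : Filter.Tendsto (fun k => ‖w (n + k)‖) Filter.atTop (nhds 0) := by
    have h : Filter.Tendsto w Filter.atTop (nhds 0) := by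
      simpa [hw] using
        ((Filter.tendsto_add_atTop_iff_nat 1).mpr hlim).sub (hlim.const_mul (t : ℂ)⁻¹)
    simpa [add_comm] using ((Filter.tendsto_add_atTop_iff_nat n).mpr h).norm
  have hle : ‖w n‖ ≤ 0 := ge_of_tendsto' hwlim (hgrow n)
  exact sub_eq_zero.mp (norm_le_zero_iff.mp hle)

/-- Every real `s` with `2 < |s|` is of the form `t + t⁻¹` with `1 < |t|`. -/
theorem exists_add_inv_eq_of_two_lt_abs {s : ℝ} (hs : 2 < |s|) :
    ∃ t : ℝ, 1 < |t| ∧ t + t⁻¹ = s := by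
  have key {r : ℝ} (hr : 2 < r) : ∃ t : ℝ, 1 < t ∧ t + t⁻¹ = r := by
    have hnn : 0 ≤ r ^ 2 - 4 := by nlinarith
    have hsq := Real.sq_sqrt hnn
    have hsn := Real.sqrt_nonneg (r ^ 2 - 4)
    have ht : 1 < (r + √(r ^ 2 - 4)) / 2 := by linarith
    refine ⟨(r + √(r ^ 2 - 4)) / 2, ht, ?_⟩
    have hne : r + √(r ^ 2 - 4) ≠ 0 := by linarith
    field_simp
    nlinarith
  rcases lt_abs.mp hs with h | h
  · obtain ⟨t, ht, hts⟩ := key h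
    exact ⟨t, lt_abs.mpr (Or.inl ht), hts⟩
  · obtain ⟨t, ht, hts⟩ := key h
    exact ⟨-t, by rwa [abs_neg, lt_abs, or_iff_left (by linarith)], by rw [inv_neg]; linarith⟩

theorem two_lt_add_inv {t : ℝ} (ht : 1 < t) : 2 < t + t⁻¹ := by
  have h : t * t⁻¹ = 1 := mul_inv_cancel₀ (by linarith)
  have hpos : 0 < t⁻¹ := inv_pos.mpr (by linarith)
  have hlt : t⁻¹ < 1 := inv_lt_one_of_one_lt₀ ht
  nlinarith

/-- The secular equation has no root `t` outside the unit interval. -/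
theorem secular_ne {a d s t : ℝ} (h1 : a ^ 2 ≤ (d - 1) * (s - 1)) (h2 : a ^ 2 ≤ (d + 1) * (s + 1))
    (hd : |d| ≤ 1) (hs : |s| ≤ 1) (ht : 1 < |t|) :
    (2 * s + (t + t⁻¹)) * (d + t) ≠ 2 * a ^ 2 := by
  have pos {d s t : ℝ} (h : a ^ 2 ≤ (d + 1) * (s + 1)) (hd : -1 ≤ d) (hs : -1 ≤ s) (ht : 1 < t) :
      2 * a ^ 2 < (2 * s + (t + t⁻¹)) * (d + t) := by
    have hg := two_lt_add_inv ht
    have h' : (2 * (s + 1)) * (d + 1) < (2 * s + (t + t⁻¹)) * (d + t) :=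
      mul_lt_mul'' (by linarith) (by linarith) (by linarith) (by linarith)
    linarith
  rw [abs_le] at hd hs
  rcases lt_abs.mp ht with ht | ht
  · exact (pos h2 hd.1 hs.1 ht).ne'
  · have h := pos (d := -d) (s := -s) (by linarith) (by linarith) (by linarith) ht
    rw [inv_neg] at h
    intro heq
    linarith

/-- Theorem 1 b): in the region `U₀(+,+)` the discrete spectrum is empty. -/
theorem stmt1 (lam lam1 mu mu1 al de si c1 c2 : ℝ)
    (hlam : 0 < lam)
    (hal : al = lam1 / lam) (hde : de = mu1 / lam) (hsi : si = (2 * lam1 + mu) / (2 * lam))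
    (hc1 : c1 = (de - 1) * (si - 1) - (al + 1) ^ 2)
    (hc2 : c2 = (de + 1) * (si + 1) - (al + 1) ^ 2)
    (halne : al ≠ -1)
    (h1 : 0 ≤ c1) (h2 : 0 ≤ c2) (h3 : |de| ≤ 1) (h4 : |si| ≤ 1) :
    discSpec lam lam1 mu mu1 = ∅ := by
  refine Set.eq_empty_of_forall_notMem ?_
  rintro ν ⟨⟨f, hf0, hsum, hf⟩, hν⟩
  obtain rfl : lam1 = al * lam := by rw [hal]; field_simp
  obtain rfl : mu1 = de * lam := by rw [hde]; field_simp
  obtain rfl : mu = 2 * lam * (si - al) := by rw [hsi]; field_simp; ring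
  obtain ⟨E, rfl⟩ : ∃ E, ν = lam * E := ⟨ν / lam, by field_simp⟩
  have hE : 2 < |2 - E| := by
    by_contra! h
    rw [abs_le] at h
    exact hν ⟨mul_nonneg hlam.le (by linarith), by nlinarith⟩
  obtain ⟨t, ht, hts⟩ := exists_add_inv_eq_of_two_lt_abs hE
  have htsC : (t : ℂ) + (t : ℂ)⁻¹ = 2 - E := by exact_mod_cast congrArg Complex.ofReal hts
  have hlamC : (lam : ℂ) ≠ 0 := by exact_mod_cast hlam.ne'
  have hrec (n : ℤ) (h0 : n ≠ 0) (h1 : n ≠ 1) (hm1 : n ≠ -1) :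
      f (n + 1) + f (n - 1) = ((t : ℂ) + (t : ℂ)⁻¹) * f n := by
    have h := hf n
    simp only [Hop, h0, h1, hm1, if_false] at h
    push_cast at h
    apply mul_left_cancel₀ hlamC
    rw [htsC]
    linear_combination -h
  have hlim : Filter.Tendsto f Filter.cofinite (nhds 0) := by
    rw [tendsto_zero_iff_norm_tendsto_zero]
    simpa using hsum.tendsto_cofinite_zero.sqrt
  have hright := geometric_of_recurrence_of_tendsto_zero ht (u := fun n => f (n + 1))
    (fun n => by
      have h := hrec (n + 2) (by omega) (by omega) (by omega)
      push_cast
      convert h using 3 <;> ring_nf)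
    (by
      rw [← Nat.cofinite_eq_atTop]
      exact hlim.comp (Function.Injective.tendsto_cofinite fun a b h => by simpa using h))
  have hleft := geometric_of_recurrence_of_tendsto_zero ht (u := fun n => f (-(n + 1)))
    (fun n => by
      have h := hrec (-(n + 2)) (by omega) (by omega) (by omega)
      rw [add_comm] at h
      push_cast
      convert h using 3 <;> ring_nf)
    (by
      rw [← Nat.cofinite_eq_atTop]
      exact hlim.comp (Function.Injective.tendsto_cofinite fun a b h => by simpa using h))
  have e0 : (2 * (si : ℂ) + (t + (t : ℂ)⁻¹)) * f 0 = (1 + al) * (f 1 + f (-1)) := by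
    have h := hf 0
    simp only [Hop, if_true] at h
    push_cast at h
    apply mul_left_cancel₀ hlamC
    rw [htsC]
    linear_combination h
  have e1 : ((de : ℂ) + t) * f 1 = (1 + al) * f 0 := by
    have h := hf 1
    have h2 : f 2 = (t : ℂ)⁻¹ * f 1 := by simpa using hright 0
    norm_num [Hop] at h
    apply mul_left_cancel₀ hlamC
    linear_combination h + lam * h2 + lam * f 1 * htsC
  have em1 : ((de : ℂ) + t) * f (-1) = (1 + al) * f 0 := by
    have h := hf (-1)
    have h2 : f (-2) = (t : ℂ)⁻¹ * f (-1) := by simpa using hleft 0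
    norm_num [Hop] at h
    apply mul_left_cancel₀ hlamC
    linear_combination h + lam * h2 + lam * f (-1) * htsC
  have hdt : (de : ℂ) + t ≠ 0 := by
    intro h
    have h' : t = -de := by
      have : de + t = 0 := by exact_mod_cast h
      linarith
    rw [h', abs_neg] at ht
    linarith
  by_cases hz : f 0 = 0
  · have hf1 : f 1 = 0 := by simpa [hz, hdt] using e1
    have hfm1 : f (-1) = 0 := by simpa [hz, hdt] using em1
    have hpos (n : ℕ) : f (n + 1) = 0 := by
      induction n with
      | zero => simpa using hf1
      | succ n ih => exact (hright n).trans (by rw [ih, mul_zero])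
    have hneg (n : ℕ) : f (-(n + 1)) = 0 := by
      induction n with
      | zero => simpa using hfm1
      | succ n ih => exact (hleft n).trans (by rw [ih, mul_zero])
    refine hf0 (funext fun n => ?_)
    rcases n with (_ | n) | n
    · exact hz
    · simpa using hpos n
    · simpa [Int.negSucc_eq] using hneg n
  · have hsec : (2 * (si : ℂ) + (t + (t : ℂ)⁻¹)) * (de + t) = 2 * (al + 1) ^ 2 := by
      apply mul_right_cancel₀ hz
      linear_combination (de + t : ℂ) * e0 + (1 + al : ℂ) * (e1 + em1)
    exact secular_ne (a := al + 1) (by linarith) (by linarith) h3 h4 ht (by exact_mod_cast hsec)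
end

section
/- Let λ > 0 and λ₁, μ, μ₁ ∈ ℝ with α = λ₁/λ ≠ -1. Assume c₁ > 0, c₂ > 0, δ < -1 and σ < -1 (i.e., (α,δ,σ) ∈ U₋₁(+,+)). Then the discrete spectrum s_d(H) consists of exactly three distinct real numbers ν₁, ν₂, ν₃, where ν₃ = κ and ν₁ < 2λ(min{σ, (δ²+1)/(2δ)} + 1) ≤ 2λ(max{σ, (δ²+1)/(2δ)} + 1) < ν₂ < 0. -/
open Filter Topology in
/-- A solution of `u (n + 2) - (w + w⁻¹) u (n + 1) + u n = 0` tending to zero, where `1 < |w|`,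
is geometric with ratio `w⁻¹`. -/
theorem succ_eq_inv_mul_of_tendsto_zero {w : ℝ} (hw : 1 < |w|) {u : ℕ → ℂ}
    (hu : ∀ n, u (n + 2) - ((w : ℂ) + (w : ℂ)⁻¹) * u (n + 1) + u n = 0)
    (hlim : Tendsto u atTop (𝓝 0)) (n : ℕ) : u (n + 1) = (w : ℂ)⁻¹ * u n := by
  have hw0 : (w : ℂ) ≠ 0 := by
    rintro h
    have : w = 0 := by exact_mod_cast h
    simp [this] at hw
    linarith
  have hstep : ∀ k, u (n + k + 1) - (w : ℂ)⁻¹ * u (n + k) =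
      (w : ℂ) ^ k * (u (n + 1) - (w : ℂ)⁻¹ * u n) := by
    intro k
    induction k with
    | zero => simp
    | succ k ih =>
      have h := hu (n + k)
      have h' : (w : ℂ) * (w : ℂ)⁻¹ = 1 := mul_inv_cancel₀ hw0
      rw [pow_succ]
      rw [show n + (k + 1) + 1 = n + k + 2 by ring, show n + (k + 1) = n + k + 1 by ring]
      linear_combination h + (w : ℂ) * ih + u (n + k) * h'
  have hg : Tendsto (fun k => ‖u (n + k + 1) - (w : ℂ)⁻¹ * u (n + k)‖) atTop (𝓝 0) := by
    have h1 : Tendsto (fun k => u (n + k)) atTop (𝓝 0) := by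
      simpa [add_comm] using (tendsto_add_atTop_iff_nat n).2 hlim
    have h2 : Tendsto (fun k => u (n + k + 1)) atTop (𝓝 0) := by
      exact (tendsto_add_atTop_iff_nat (f := fun k => u (n + k)) 1).2 h1
    simpa using (h2.sub (h1.const_mul (w : ℂ)⁻¹)).norm
  have hle : ‖u (n + 1) - (w : ℂ)⁻¹ * u n‖ ≤ 0 := by
    refine ge_of_tendsto' hg fun k => ?_
    rw [hstep k, norm_mul, norm_pow, Complex.norm_real, Real.norm_eq_abs]
    exact le_mul_of_one_le_left (norm_nonneg _) (one_le_pow₀ hw.le)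
  exact sub_eq_zero.1 (norm_le_zero_iff.1 hle)

/-- The sequence on `ℤ` with value `x` at `0` that is geometric of ratio `z` on either side,
starting from `p` at `1` and from `q` at `-1`. -/
def twoSidedGeom (z x p q : ℂ) : ℤ → ℂ
  | Int.ofNat 0 => x
  | Int.ofNat (n + 1) => p * z ^ n
  | Int.negSucc n => q * z ^ n

theorem twoSidedGeom_zero (z x p q : ℂ) : twoSidedGeom z x p q 0 = x := rfl

theorem twoSidedGeom_natCast_add_one (z x p q : ℂ) (n : ℕ) :
    twoSidedGeom z x p q ((n : ℤ) + 1) = p * z ^ n := rfl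

theorem twoSidedGeom_neg_natCast_add_one (z x p q : ℂ) (n : ℕ) :
    twoSidedGeom z x p q (-((n : ℤ) + 1)) = q * z ^ n := by
  rw [← Int.negSucc_eq]; rfl

theorem summable_norm_sq_twoSidedGeom {z : ℂ} (hz : ‖z‖ < 1) (x p q : ℂ) :
    Summable fun n : ℤ => ‖twoSidedGeom z x p q n‖ ^ 2 := by
  have hs : ∀ y : ℂ, Summable fun n : ℕ => ‖y * z ^ n‖ ^ 2 := by
    intro y
    have h : (fun n : ℕ => ‖y * z ^ n‖ ^ 2) = fun n => ‖y‖ ^ 2 * (‖z‖ ^ 2) ^ n := by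
      funext n
      rw [norm_mul, norm_pow, mul_pow, ← pow_mul, ← pow_mul, mul_comm n 2]
    rw [h]
    refine (summable_geometric_of_lt_one (by positivity) ?_).mul_left _
    exact pow_lt_one₀ (norm_nonneg _) hz two_ne_zero
  refine Summable.of_nat_of_neg_add_one ?_ ?_
  · rw [← summable_nat_add_iff 1]
    refine (hs p).congr fun n => ?_
    push_cast
    rw [twoSidedGeom_natCast_add_one]
  · refine (hs q).congr fun n => ?_
    rw [twoSidedGeom_neg_natCast_add_one]

section Hop

variable (lam lam1 mu mu1 : ℝ) (f : ℤ → ℂ)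

theorem Hop_zero : Hop lam lam1 mu mu1 f 0 =
    -((lam : ℂ) + lam1) * (f 1 - 2 * f 0 + f (-1)) + (mu : ℂ) * f 0 := by
  simp [Hop]

theorem Hop_one : Hop lam lam1 mu mu1 f 1 =
    -(lam : ℂ) * (f 2 - 2 * f 1 + f 0) - (lam1 : ℂ) * f 0 + (mu1 : ℂ) * f 1 := by
  simp [Hop]

theorem Hop_neg_one : Hop lam lam1 mu mu1 f (-1) =
    -(lam : ℂ) * (f 0 - 2 * f (-1) + f (-2)) - (lam1 : ℂ) * f 0 + (mu1 : ℂ) * f (-1) := by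
  simp [Hop]

theorem Hop_natCast_add_two (n : ℕ) : Hop lam lam1 mu mu1 f ((n : ℤ) + 2) =
    -(lam : ℂ) * (f ((n : ℤ) + 3) - 2 * f ((n : ℤ) + 2) + f ((n : ℤ) + 1)) := by
  have h0 : (n : ℤ) + 2 ≠ 0 := by omega
  have h1 : (n : ℤ) + 2 ≠ 1 := by omega
  have h2 : (n : ℤ) + 2 ≠ -1 := by omega
  simp only [Hop, h0, h1, h2, if_false]
  rw [show (n : ℤ) + 2 + 1 = n + 3 by ring, show (n : ℤ) + 2 - 1 = n + 1 by ring]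

theorem Hop_neg_natCast_add_two (n : ℕ) : Hop lam lam1 mu mu1 f (-((n : ℤ) + 2)) =
    -(lam : ℂ) * (f (-((n : ℤ) + 3)) - 2 * f (-((n : ℤ) + 2)) + f (-((n : ℤ) + 1))) := by
  have h0 : -((n : ℤ) + 2) ≠ 0 := by omega
  have h1 : -((n : ℤ) + 2) ≠ 1 := by omega
  have h2 : -((n : ℤ) + 2) ≠ -1 := by omega
  simp only [Hop, h0, h1, h2, if_false]
  rw [show -((n : ℤ) + 2) + 1 = -(n + 1) by ring, show -((n : ℤ) + 2) - 1 = -(n + 3) by ring]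
  ring

end Hop

open Filter Topology in
/-- For `1 < |w|`, the number `lam * (2 - w - w⁻¹)` is an eigenvalue exactly when the `3 × 3` linear
system for the values of an eigenfunction at `0`, `1` and `-1` has a nontrivial solution. -/
theorem isEigenvalue_iff_exists_linear {lam lam1 mu mu1 w : ℝ} (hlam : 0 < lam) (hw : 1 < |w|) :
    IsEigenvalue lam lam1 mu mu1 (lam * (2 - w - w⁻¹)) ↔
      ∃ x p q : ℂ, ¬ (x = 0 ∧ p = 0 ∧ q = 0) ∧
        ((lam * w + mu1 : ℝ) : ℂ) * p = ((lam + lam1 : ℝ) : ℂ) * x ∧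
        ((lam * w + mu1 : ℝ) : ℂ) * q = ((lam + lam1 : ℝ) : ℂ) * x ∧
        ((2 * lam1 + mu + lam * (w + w⁻¹) : ℝ) : ℂ) * x = ((lam + lam1 : ℝ) : ℂ) * (p + q) := by
  have hw0 : w ≠ 0 := by
    rintro rfl
    simp at hw
    linarith
  have hww : (w : ℂ) * (w : ℂ)⁻¹ = 1 := mul_inv_cancel₀ (by exact_mod_cast hw0)
  have hl0 : (lam : ℂ) ≠ 0 := by exact_mod_cast hlam.ne'
  constructor
  · rintro ⟨f, hf, hsum, hH⟩
    have hlim : Tendsto f cofinite (𝓝 0) := by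
      have h := hsum.tendsto_cofinite_zero.sqrt
      simp only [Real.sqrt_zero, Real.sqrt_sq (norm_nonneg _)] at h
      exact tendsto_zero_iff_norm_tendsto_zero.2 h
    have hR := succ_eq_inv_mul_of_tendsto_zero hw (u := fun n : ℕ => f ((n : ℤ) + 1))
      (fun n => by
        have h := hH ((n : ℤ) + 2)
        rw [Hop_natCast_add_two] at h
        push_cast at h ⊢
        rw [show (n : ℤ) + 2 + 1 = n + 3 by ring, show (n : ℤ) + 1 + 1 = n + 2 by ring]
        refine mul_left_cancel₀ hl0 ?_
        linear_combination -h)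
      (hlim.comp (Nat.cofinite_eq_atTop ▸ Function.Injective.tendsto_cofinite
        (f := fun n : ℕ => (n : ℤ) + 1) (fun a b h => by simpa using h)))
    have hL := succ_eq_inv_mul_of_tendsto_zero hw (u := fun n : ℕ => f (-((n : ℤ) + 1)))
      (fun n => by
        have h := hH (-((n : ℤ) + 2))
        rw [Hop_neg_natCast_add_two] at h
        push_cast at h ⊢
        rw [show (n : ℤ) + 2 + 1 = n + 3 by ring, show (n : ℤ) + 1 + 1 = n + 2 by ring]
        refine mul_left_cancel₀ hl0 ?_
        linear_combination -h)
      (hlim.comp (Nat.cofinite_eq_atTop ▸ Function.Injective.tendsto_cofinite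
        (f := fun n : ℕ => -((n : ℤ) + 1)) (fun a b h => by simpa using h)))
    have hR0 : f 2 = (w : ℂ)⁻¹ * f 1 := hR 0
    have hL0 : f (-2) = (w : ℂ)⁻¹ * f (-1) := hL 0
    refine ⟨f 0, f 1, f (-1), ?_, ?_, ?_, ?_⟩
    · rintro ⟨hx, hp, hq⟩
      have hRn : ∀ n : ℕ, f ((n : ℤ) + 1) = 0 := by
        intro n
        induction n with
        | zero => simpa using hp
        | succ n ih => rw [hR n, ih, mul_zero]
      have hLn : ∀ n : ℕ, f (-((n : ℤ) + 1)) = 0 := by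
        intro n
        induction n with
        | zero => simpa using hq
        | succ n ih => rw [hL n, ih, mul_zero]
      refine hf (funext fun n => ?_)
      rcases lt_trichotomy n 0 with h | rfl | h
      · obtain ⟨k, rfl⟩ : ∃ k : ℕ, n = -((k : ℤ) + 1) := ⟨(-n - 1).toNat, by omega⟩
        exact hLn k
      · exact hx
      · obtain ⟨k, rfl⟩ : ∃ k : ℕ, n = (k : ℤ) + 1 := ⟨(n - 1).toNat, by omega⟩
        exact hRn k
    · have h := hH 1
      rw [Hop_one, hR0] at h
      push_cast at h ⊢
      linear_combination h
    · have h := hH (-1)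
      rw [Hop_neg_one, hL0] at h
      push_cast at h ⊢
      linear_combination h
    · have h := hH 0
      rw [Hop_zero] at h
      push_cast at h ⊢
      linear_combination h
  · rintro ⟨x, p, q, hne, hp, hq, hx⟩
    push_cast at hp hq hx
    set f := twoSidedGeom (w : ℂ)⁻¹ x p q with hfdef
    have hR : ∀ n : ℕ, f ((n : ℤ) + 1) = p * ((w : ℂ)⁻¹) ^ n :=
      twoSidedGeom_natCast_add_one _ _ _ _
    have hL : ∀ n : ℕ, f (-((n : ℤ) + 1)) = q * ((w : ℂ)⁻¹) ^ n :=
      twoSidedGeom_neg_natCast_add_one _ _ _ _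
    have f0 : f 0 = x := rfl
    have f1 : f 1 = p := by simpa using hR 0
    have f2 : f 2 = p * (w : ℂ)⁻¹ := by simpa using hR 1
    have g1 : f (-1) = q := by simpa using hL 0
    have g2 : f (-2) = q * (w : ℂ)⁻¹ := by simpa using hL 1
    refine ⟨f, fun h => hne ?_, summable_norm_sq_twoSidedGeom ?_ x p q, fun n => ?_⟩
    · rw [← f0, ← f1, ← g1, h]
      simp
    · rw [norm_inv, Complex.norm_real, Real.norm_eq_abs]
      exact inv_lt_one_of_one_lt₀ hw
    · obtain rfl | rfl | rfl | ⟨k, rfl⟩ | ⟨k, rfl⟩ : n = 0 ∨ n = 1 ∨ n = -1 ∨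
          (∃ k : ℕ, n = (k : ℤ) + 2) ∨ ∃ k : ℕ, n = -((k : ℤ) + 2) := by
        rcases lt_or_ge n 2 with h | h
        · rcases lt_or_ge (-2) n with h' | h'
          · omega
          · exact .inr (.inr (.inr (.inr ⟨(-n - 2).toNat, by omega⟩)))
        · exact .inr (.inr (.inr (.inl ⟨(n - 2).toNat, by omega⟩)))
      · rw [Hop_zero, f0, f1, g1]
        push_cast
        linear_combination hx
      · rw [Hop_one, f0, f1, f2]
        push_cast
        linear_combination hp
      · rw [Hop_neg_one, f0, g1, g2]
        push_cast
        linear_combination hq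
      · have e3 := hR (k + 2)
        have e2 := hR (k + 1)
        push_cast at e2 e3
        rw [show (k : ℤ) + 2 + 1 = k + 3 by ring] at e3
        rw [show (k : ℤ) + 1 + 1 = k + 2 by ring] at e2
        rw [Hop_natCast_add_two, hR k, e2, e3]
        push_cast
        linear_combination (lam * p * (w : ℂ)⁻¹ ^ k) * hww
      · have e3 := hL (k + 2)
        have e2 := hL (k + 1)
        push_cast at e2 e3
        rw [show (k : ℤ) + 2 + 1 = k + 3 by ring] at e3
        rw [show (k : ℤ) + 1 + 1 = k + 2 by ring] at e2
        rw [Hop_neg_natCast_add_two, hL k, e2, e3]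
        push_cast
        linear_combination (lam * q * (w : ℂ)⁻¹ ^ k) * hww

/-- For `1 < |w|`, the number `lam * (2 - w - w⁻¹)` is an eigenvalue exactly when `w` solves the odd
secular equation `w = -δ` or the even one. -/
theorem isEigenvalue_iff_secular {lam al de si w : ℝ} (hlam : 0 < lam) (hal : al ≠ -1)
    (hw : 1 < |w|) :
    IsEigenvalue lam (lam * al) (2 * lam * si - 2 * (lam * al)) (lam * de)
        (lam * (2 - w - w⁻¹)) ↔
      w + de = 0 ∨ (w + de) * (si + (w + w⁻¹) / 2) = (al + 1) ^ 2 := by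
  rw [isEigenvalue_iff_exists_linear hlam hw,
    show lam * w + lam * de = lam * (w + de) by ring,
    show lam + lam * al = lam * (1 + al) by ring,
    show 2 * (lam * al) + (2 * lam * si - 2 * (lam * al)) + lam * (w + w⁻¹) =
      2 * lam * (si + (w + w⁻¹) / 2) by ring]
  constructor
  · rintro ⟨x, p, q, hne, hp, hq, hx⟩
    by_contra! hcon
    have hb : ((lam * (w + de) : ℝ) : ℂ) ≠ 0 :=
      Complex.ofReal_ne_zero.2 (mul_ne_zero hlam.ne' hcon.1)
    have hmul : ((2 * lam ^ 2 * ((w + de) * (si + (w + w⁻¹) / 2) - (al + 1) ^ 2) : ℝ) : ℂ) * x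
        = 0 := by
      push_cast at hp hq hx ⊢
      linear_combination (lam * (w + de) : ℂ) * hx + (lam * (1 + al) : ℂ) * (hp + hq)
    have hx0 : x = 0 := by
      refine (mul_eq_zero.1 hmul).resolve_left (Complex.ofReal_ne_zero.2 ?_)
      exact mul_ne_zero (by positivity) (sub_ne_zero.2 hcon.2)
    rw [hx0, mul_zero] at hp hq
    exact hne ⟨hx0, (mul_eq_zero.1 hp).resolve_left hb, (mul_eq_zero.1 hq).resolve_left hb⟩
  · rintro (h | h)
    · exact ⟨0, 1, -1, by simp, by simp [h], by simp [h], by simp⟩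
    · refine ⟨((w + de : ℝ) : ℂ), ((1 + al : ℝ) : ℂ), ((1 + al : ℝ) : ℂ), ?_, ?_, ?_, ?_⟩
      · rintro ⟨-, h1, -⟩
        rw [Complex.ofReal_eq_zero] at h1
        exact hal (by linarith)
      · norm_cast
        ring
      · norm_cast
        ring
      · norm_cast
        linear_combination 2 * lam * h

/-- Every real number outside `[0, 4 * lam]` is `lam * (2 - w - w⁻¹)` for some `w` with
`1 < |w|`. -/
theorem exists_eq_mul_two_sub_sub_inv {lam ν : ℝ} (hlam : 0 < lam)
    (hν : ν ∉ Set.Icc 0 (4 * lam)) : ∃ w : ℝ, 1 < |w| ∧ ν = lam * (2 - w - w⁻¹) := by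
  have key : ∀ t : ℝ, 2 < t → ∃ w : ℝ, 1 < w ∧ w + w⁻¹ = t := by
    intro t ht
    have hs : 0 ≤ t ^ 2 - 4 := by nlinarith
    have hr := Real.sq_sqrt hs
    have hr0 := Real.sqrt_nonneg (t ^ 2 - 4)
    refine ⟨(t + √(t ^ 2 - 4)) / 2, by linarith, ?_⟩
    have : t + √(t ^ 2 - 4) ≠ 0 := by linarith
    field_simp
    linear_combination hr
  have hval : ∀ w : ℝ, w + w⁻¹ = 2 - ν / lam → ν = lam * (2 - w - w⁻¹) := by
    intro w h
    rw [sub_sub, h]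
    field_simp
    ring
  rcases lt_or_ge ν 0 with h | h
  · have : ν / lam < 0 := div_neg_of_neg_of_pos h hlam
    obtain ⟨w, hw, he⟩ := key (2 - ν / lam) (by linarith)
    exact ⟨w, hw.trans_le (le_abs_self w), hval w he⟩
  · have h4 : 4 * lam < ν := lt_of_not_ge fun h' => hν ⟨h, h'⟩
    have : 4 < ν / lam := (lt_div_iff₀ hlam).2 h4
    obtain ⟨w, hw, he⟩ := key (ν / lam - 2) (by linarith)
    refine ⟨-w, by rw [abs_neg]; exact hw.trans_le (le_abs_self w), hval _ ?_⟩
    rw [inv_neg]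
    linarith

theorem add_inv_lt_add_inv_s2 {v w : ℝ} (hv : 1 ≤ v) (h : v < w) : v + v⁻¹ < w + w⁻¹ := by
  have hv0 : 0 < v := by linarith
  have hw0 : 0 < w := by linarith
  have : w + w⁻¹ - (v + v⁻¹) = (w - v) * (v * w - 1) / (v * w) := by
    field_simp
    ring
  have h2 : 0 < (w - v) * (v * w - 1) / (v * w) :=
    div_pos (mul_pos (by linarith) (by nlinarith)) (by positivity)
  linarith

/-- The even secular equation has exactly two solutions with `1 < |w|`, on either side of `-δ`. -/
theorem exists_roots_secular {al de si : ℝ} (hal : al ≠ -1)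
    (h1 : 0 < (de - 1) * (si - 1) - (al + 1) ^ 2)
    (h2 : 0 < (de + 1) * (si + 1) - (al + 1) ^ 2) (h3 : de < -1) (h4 : si < -1) :
    ∃ v w : ℝ, 1 < v ∧ v < -de ∧ si + (v + v⁻¹) / 2 < 0 ∧ -de < w ∧ 0 < si + (w + w⁻¹) / 2 ∧
      ∀ y : ℝ, 1 < |y| →
        ((y + de) * (si + (y + y⁻¹) / 2) = (al + 1) ^ 2 ↔ y = v ∨ y = w) := by
  have ha : 0 < (al + 1) ^ 2 := by
    have : al + 1 ≠ 0 := fun h => hal (by linarith)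
    positivity
  set G : ℝ → ℝ := fun y => (y + de) * (si + (y + y⁻¹) / 2) with hG
  have hcont : ContinuousOn G (Set.Ici 1) := by
    have h0 : ∀ y ∈ Set.Ici (1 : ℝ), y ≠ 0 := fun y hy => by
      have : (1 : ℝ) ≤ y := hy
      linarith
    fun_prop (disch := assumption)
  have hG1 : (al + 1) ^ 2 < G 1 := by
    simp only [hG]
    norm_num
    linarith
  have hGd : G (-de) = 0 := by simp [hG]
  set W : ℝ := -de + 1 + 2 * (al + 1) ^ 2 - 2 * si with hW
  have hGW : (al + 1) ^ 2 < G W := by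
    have hW0 : 0 < W⁻¹ := inv_pos.2 (by linarith)
    simp only [hG]
    nlinarith
  obtain ⟨v, ⟨hv1, hv2⟩, hv⟩ := intermediate_value_Ioo' (by linarith : (1 : ℝ) ≤ -de)
    (hcont.mono fun y hy => hy.1) (show (al + 1) ^ 2 ∈ Set.Ioo (G (-de)) (G 1) from
      ⟨by rw [hGd]; exact ha, hG1⟩)
  obtain ⟨w, ⟨hw1, hw2⟩, hw⟩ := intermediate_value_Ioo (by linarith : -de ≤ W)
    (hcont.mono fun y hy => le_trans (by linarith) hy.1)
    (show (al + 1) ^ 2 ∈ Set.Ioo (G (-de)) (G W) from ⟨by rw [hGd]; exact ha, hGW⟩)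
  have hneg : ∀ y, y < -de → G y = (al + 1) ^ 2 → si + (y + y⁻¹) / 2 < 0 := by
    intro y hy h
    have : 0 < (y + de) * (si + (y + y⁻¹) / 2) := ha.trans_eq h.symm
    exact neg_of_mul_pos_right this (by linarith)
  have hpos : ∀ y, -de < y → G y = (al + 1) ^ 2 → 0 < si + (y + y⁻¹) / 2 := by
    intro y hy h
    have : 0 < (y + de) * (si + (y + y⁻¹) / 2) := ha.trans_eq h.symm
    exact pos_of_mul_pos_right this (by linarith)
  have hanti : ∀ y z, 1 < y → y < z → z < -de → G y = (al + 1) ^ 2 → G z ≠ (al + 1) ^ 2 := by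
    intro y z hy hyz hz ey ez
    have := hneg y (by linarith) ey
    have := hneg z hz ez
    have := add_inv_lt_add_inv_s2 hy.le hyz
    have : G z < G y := by
      simp only [hG]
      nlinarith
    linarith
  have hmono : ∀ y z, -de < y → y < z → G y = (al + 1) ^ 2 → G z ≠ (al + 1) ^ 2 := by
    intro y z hy hyz ey ez
    have := hpos y hy ey
    have := hpos z (by linarith) ez
    have := add_inv_lt_add_inv_s2 (by linarith) hyz
    have : G y < G z := by
      simp only [hG]
      nlinarith
    linarith
  refine ⟨v, w, hv1, hv2, hneg v hv2 hv, hw1, hpos w hw1 hw, fun y hy => ⟨fun h => ?_, ?_⟩⟩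
  · rcases lt_abs.1 hy with hy | hy
    · rcases lt_trichotomy y (-de) with hd | hd | hd
      · left
        rcases lt_trichotomy y v with h' | h' | h'
        · exact absurd hv (hanti y v hy h' hv2 h)
        · exact h'
        · exact absurd h (hanti v y hv1 h' hd hv)
      · rw [hd, neg_add_cancel, zero_mul] at h
        exact absurd h ha.ne
      · right
        rcases lt_trichotomy y w with h' | h' | h'
        · exact absurd hw (hmono y w hd h' h)
        · exact h'
        · exact absurd h (hmono w y hw1 h' hw)
    · have := add_inv_lt_add_inv_s2 le_rfl hy
      rw [inv_neg, inv_one] at this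
      nlinarith
  · rintro (rfl | rfl)
    · exact hv
    · exact hw

/-- Theorem 1 c): in the region `U₋₁(+,+)` the discrete spectrum consists of exactly three
distinct eigenvalues `ν₁, ν₂, ν₃` with `ν₃ = κ` and
`ν₁ < 2λ(min{σ, (δ²+1)/(2δ)} + 1) ≤ 2λ(max{σ, (δ²+1)/(2δ)} + 1) < ν₂ < 0`. -/
theorem stmt2 (lam lam1 mu mu1 al de si c1 c2 kap : ℝ)
    (hlam : 0 < lam)
    (hal : al = lam1 / lam) (hde : de = mu1 / lam) (hsi : si = (2 * lam1 + mu) / (2 * lam))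
    (hc1 : c1 = (de - 1) * (si - 1) - (al + 1) ^ 2)
    (hc2 : c2 = (de + 1) * (si + 1) - (al + 1) ^ 2)
    (hkap : kap = (mu1 + lam) ^ 2 / mu1)
    (halne : al ≠ -1)
    (h1 : 0 < c1) (h2 : 0 < c2) (h3 : de < -1) (h4 : si < -1) :
    ∃ ν1 ν2 ν3 : ℝ,
      ν3 = kap ∧
      ν1 < 2 * lam * (min si ((de ^ 2 + 1) / (2 * de)) + 1) ∧
      2 * lam * (min si ((de ^ 2 + 1) / (2 * de)) + 1) ≤
        2 * lam * (max si ((de ^ 2 + 1) / (2 * de)) + 1) ∧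
      2 * lam * (max si ((de ^ 2 + 1) / (2 * de)) + 1) < ν2 ∧
      ν2 < 0 ∧
      ν1 ≠ ν2 ∧ ν1 ≠ ν3 ∧ ν2 ≠ ν3 ∧
      discSpec lam lam1 mu mu1 = {ν1, ν2, ν3} := by
  obtain rfl : lam1 = lam * al := by rw [hal]; field_simp
  obtain rfl : mu1 = lam * de := by rw [hde]; field_simp
  obtain rfl : mu = 2 * lam * si - 2 * (lam * al) := by rw [hsi]; field_simp; ring
  subst hc1 hc2
  obtain ⟨v, w, hv1, hv2, hv, hw1, hw, hroots⟩ := exists_roots_secular halne h1 h2 h3 h4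
  set E : ℝ → ℝ := fun y => lam * (2 - y - y⁻¹) with hE
  have hEanti : ∀ y z, 1 ≤ y → y < z → E z < E y := by
    intro y z hy hyz
    have := add_inv_lt_add_inv_s2 hy hyz
    exact mul_lt_mul_of_pos_left (by linarith) hlam
  have hE1 : E 1 = 0 := by simp only [hE]; norm_num
  have hEneg : ∀ y, 1 < y → E y < 0 := fun y hy => hE1 ▸ hEanti 1 y le_rfl hy
  have hde0 : de ≠ 0 := by linarith
  have hkapE : kap = E (-de) := by
    rw [hkap]
    simp only [hE, inv_neg]
    field_simp
    ring
  have hkapd : E (-de) = 2 * lam * ((de ^ 2 + 1) / (2 * de) + 1) := by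
    simp only [hE, inv_neg]
    field_simp
    ring
  have hwd : E w < E (-de) := hEanti _ _ (by linarith) hw1
  have hdv : E (-de) < E v := hEanti _ _ hv1.le hv2
  have hws : E w < 2 * lam * (si + 1) := by
    simp only [hE]
    nlinarith
  have hvs : 2 * lam * (si + 1) < E v := by
    simp only [hE]
    nlinarith
  refine ⟨E w, E v, kap, rfl, ?_, ?_, ?_, hEneg v hv1, (hwd.trans hdv).ne, ?_, ?_, ?_⟩
  · rcases min_choice si ((de ^ 2 + 1) / (2 * de)) with h | h <;> rw [h]
    · exact hws
    · exact hkapd ▸ hwd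
  · have := min_le_max (a := si) (b := (de ^ 2 + 1) / (2 * de))
    gcongr
  · rcases max_choice si ((de ^ 2 + 1) / (2 * de)) with h | h <;> rw [h]
    · exact hvs
    · exact hkapd ▸ hdv
  · exact hkapE ▸ hwd.ne
  · exact hkapE ▸ hdv.ne'
  · rw [hkapE]
    have hmem : ∀ y, 1 < y → (y + de = 0 ∨ y = v ∨ y = w) →
        E y ∈ discSpec lam (lam * al) (2 * lam * si - 2 * (lam * al)) (lam * de) := by
      intro y hy h
      have hy' : 1 < |y| := hy.trans_le (le_abs_self y)
      refine ⟨(isEigenvalue_iff_secular hlam halne hy').2 (h.imp_right (hroots y hy').2), ?_⟩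
      exact fun hc => absurd hc.1 (hEneg y hy).not_ge
    ext ν
    simp only [Set.mem_insert_iff, Set.mem_singleton_iff]
    constructor
    · rintro ⟨hev, hν⟩
      obtain ⟨y, hy, rfl⟩ := exists_eq_mul_two_sub_sub_inv hlam hν
      rw [isEigenvalue_iff_secular hlam halne hy, hroots y hy] at hev
      rcases hev with h | rfl | rfl
      · rw [show y = -de by linarith]
        exact .inr (.inr rfl)
      · exact .inr (.inl rfl)
      · exact .inl rfl
    · rintro (rfl | rfl | rfl)
      · exact hmem w (by linarith) (.inr (.inr rfl))
      · exact hmem v hv1 (.inr (.inl rfl))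
      · exact hmem (-de) (by linarith) (.inl (by ring))
end

section
/- Let λ > 0 and λ₁, μ, μ₁ ∈ ℝ with α = λ₁/λ ≠ -1. Assume either (c₁ ≥ 0 and c₂ < 0) or (c₁ > 0, c₂ = 0, δ < -1 and σ < -1) (i.e., (α,δ,σ) ∈ U(+,-)). Then: if |δ| ≤ 1, the discrete spectrum s_d(H) consists of exactly one real number ν₁, and ν₁ ∈ (-∞, 0); if |δ| > 1, the discrete spectrum s_d(H) consists of exactly two distinct real numbers ν₁ and ν₂, where ν₁ ∈ (-∞, 0) and ν₂ = κ. -/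
open Filter Topology

/-- The energy `λ (2 - w - w⁻¹)`; for `1 < |w|` it parametrizes the complement of `[0, 4λ]`. -/
noncomputable def energy (lam w : ℝ) : ℝ := lam * (2 - w - w⁻¹)

/-- The secular function of the even sector of `H`, with `a = α + 1`. -/
noncomputable def secular (a de si w : ℝ) : ℝ := w + w⁻¹ + 2 * si - 2 * a ^ 2 / (w + de)

theorem secular_lt_secular {a de si x y : ℝ} (ha : a ≠ 0) (hxy : x < y) (h1 : 1 ≤ x * y)
    (h2 : 0 < (x + de) * (y + de)) : secular a de si x < secular a de si y := by
  have hx : x ≠ 0 := by rintro rfl; norm_num at h1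
  have hy : y ≠ 0 := by rintro rfl; norm_num at h1
  have hxd : x + de ≠ 0 := left_ne_zero_of_mul h2.ne'
  have hyd : y + de ≠ 0 := right_ne_zero_of_mul h2.ne'
  have hdiff : secular a de si y - secular a de si x =
      (y - x) * (1 - (x * y)⁻¹ + 2 * a ^ 2 / ((x + de) * (y + de))) := by
    unfold secular
    field_simp
    ring
  have h3 : (x * y)⁻¹ ≤ 1 := inv_le_one_of_one_le₀ h1
  have h4 : 0 < 2 * a ^ 2 / ((x + de) * (y + de)) := by positivity
  have := mul_pos (sub_pos.2 hxy) (by linarith :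
    0 < 1 - (x * y)⁻¹ + 2 * a ^ 2 / ((x + de) * (y + de)))
  linarith

theorem secular_eq_zero_iff {a de si w : ℝ} (hwd : w + de ≠ 0) :
    secular a de si w = 0 ↔ (w + w⁻¹ + 2 * si) * (w + de) = 2 * a ^ 2 := by
  unfold secular
  rw [sub_eq_zero, eq_div_iff hwd]

theorem exists_unique_secular_root {a de si : ℝ} (ha : a ≠ 0)
    (hreg : (0 ≤ (de - 1) * (si - 1) - a ^ 2 ∧ (de + 1) * (si + 1) - a ^ 2 < 0) ∨
      (0 < (de - 1) * (si - 1) - a ^ 2 ∧ (de + 1) * (si + 1) - a ^ 2 = 0 ∧ de < -1 ∧ si < -1)) :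
    ∃ w, 1 < w ∧ -de < w ∧ ∀ x, 1 < |x| →
      ((x + x⁻¹ + 2 * si) * (x + de) = 2 * a ^ 2 ↔ x = w) := by
  have ha2 : 0 < a ^ 2 := by positivity
  have hc1 : 0 ≤ (de - 1) * (si - 1) - a ^ 2 := by rcases hreg with h | h <;> linarith [h.1]
  have hc2 : (de + 1) * (si + 1) - a ^ 2 ≤ 0 := by rcases hreg with h | h <;> linarith [h.2]
  have hde : de < 1 := by
    by_contra! h
    rcases h.eq_or_lt with rfl | h
    · linarith
    · nlinarith
  have hex : ∃ w, 1 < w ∧ -de < w ∧ (w + w⁻¹ + 2 * si) * (w + de) = 2 * a ^ 2 := by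
    set m := max 1 (-de) with hm
    set W := m + 2 * |si| + |de| + a ^ 2 + 2 with hW
    have hm1 : 1 ≤ m := le_max_left _ _
    have hmd : -de ≤ m := le_max_right _ _
    have hmW : m ≤ W := by have := abs_nonneg si; have := abs_nonneg de; linarith
    have hcont : ContinuousOn (fun w : ℝ => (w + w⁻¹ + 2 * si) * (w + de)) (Set.Icc m W) := by
      have : ∀ w ∈ Set.Icc m W, w ≠ 0 := fun w hw => by linarith [hw.1] |> ne_of_gt
      fun_prop (disch := assumption)
    have hlow : (m + m⁻¹ + 2 * si) * (m + de) < 2 * a ^ 2 := by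
      rcases le_or_gt (-1) de with h | h
      · have : m = 1 := max_eq_left (by linarith)
        rw [this]
        rcases hreg with h' | h'
        · norm_num; linarith [h'.2]
        · linarith [h'.2.2.1]
      · have : m = -de := max_eq_right (by linarith)
        rw [this, neg_add_cancel, mul_zero]
        positivity
    have hhigh : 2 * a ^ 2 < (W + W⁻¹ + 2 * si) * (W + de) := by
      have hWi : 0 < W⁻¹ := by positivity
      have h1 : 2 ≤ W + W⁻¹ + 2 * si := by
        linarith [neg_abs_le si, abs_nonneg de]
      have h2 : a ^ 2 < W + de := by
        linarith [neg_abs_le de, abs_nonneg si]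
      nlinarith
    obtain ⟨w, hw, hw'⟩ := intermediate_value_Ioo hmW hcont ⟨hlow, hhigh⟩
    exact ⟨w, hm1.trans_lt hw.1, hmd.trans_lt hw.1, hw'⟩
  obtain ⟨w, hw1, hwd, hw⟩ := hex
  refine ⟨w, hw1, hwd, fun x hx => ⟨fun h => ?_, fun h => h ▸ hw⟩⟩
  have hxd : x + de ≠ 0 := by
    intro h0
    rw [h0] at h
    linarith
  have hw0 := (secular_eq_zero_iff (a := a) (si := si) (by linarith : w + de ≠ 0)).2 hw
  have hx0 := (secular_eq_zero_iff (a := a) (si := si) hxd).2 h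
  rcases lt_abs.1 hx with hx | hx
  · rcases lt_or_gt_of_ne hxd with hneg | hpos
    · have h1 : secular a de si 1 < secular a de si x :=
        secular_lt_secular ha hx (by linarith) (mul_pos_of_neg_of_neg (by linarith) hneg)
      have h2 : secular a de si 1 = 2 * ((de + 1) * (si + 1) - a ^ 2) / (de + 1) := by
        have : 1 + de ≠ 0 := by linarith
        have : de + 1 ≠ 0 := by linarith
        unfold secular
        field_simp
        ring
      have h3 : 0 ≤ 2 * ((de + 1) * (si + 1) - a ^ 2) / (de + 1) :=
        div_nonneg_of_nonpos (by linarith) (by linarith)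
      linarith
    · rcases lt_trichotomy x w with hlt | heq | hlt
      · have := secular_lt_secular (si := si) ha hlt (by nlinarith)
          (mul_pos hpos (by linarith : 0 < w + de))
        linarith
      · exact heq
      · have := secular_lt_secular (si := si) ha hlt (by nlinarith)
          (mul_pos (by linarith : 0 < w + de) hpos)
        linarith
  · have h1 : secular a de si x < secular a de si (-1) :=
      secular_lt_secular ha (by linarith) (by linarith)
        (mul_pos_of_neg_of_neg (by linarith) (by linarith))
    have h2 : secular a de si (-1) = 2 * ((de - 1) * (si - 1) - a ^ 2) / (de - 1) := by
      have : -1 + de ≠ 0 := by linarith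
      have : de - 1 ≠ 0 := by linarith
      unfold secular
      field_simp
      ring
    have h3 : 2 * ((de - 1) * (si - 1) - a ^ 2) / (de - 1) ≤ 0 :=
      div_nonpos_of_nonneg_of_nonpos (by linarith) (by linarith)
    linarith

theorem energy_neg {lam w : ℝ} (hlam : 0 < lam) (hw : 1 < w) : energy lam w < 0 := by
  have h : 2 - w - w⁻¹ = -((w - 1) ^ 2 / w) := by
    field_simp
    ring
  have : 0 < (w - 1) ^ 2 / w := div_pos (pow_pos (by linarith) 2) (by linarith)
  unfold energy
  rw [h]
  nlinarith

theorem energy_notMem_Icc {lam w : ℝ} (hlam : 0 < lam) (hw : 1 < |w|) :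
    energy lam w ∉ Set.Icc 0 (4 * lam) := by
  rcases lt_abs.1 hw with h | h
  · exact fun h' => (energy_neg hlam h).not_ge h'.1
  · intro h'
    have h1 := energy_neg hlam h
    have h2 := h'.2
    unfold energy at h1 h2
    rw [inv_neg] at h1
    linarith

theorem exists_energy_eq {lam ν : ℝ} (hlam : 0 < lam) (hν : ν ∉ Set.Icc 0 (4 * lam)) :
    ∃ w, 1 < |w| ∧ ν = energy lam w := by
  have key : ∀ t : ℝ, 2 < t → ∃ w, 1 < w ∧ w + w⁻¹ = t := fun t ht => by
    have hs : Real.sqrt (t ^ 2 - 4) ^ 2 = t ^ 2 - 4 := Real.sq_sqrt (by nlinarith)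
    have hs0 := Real.sqrt_nonneg (t ^ 2 - 4)
    have hw : 1 < (t + Real.sqrt (t ^ 2 - 4)) / 2 := by linarith
    refine ⟨_, hw, ?_⟩
    have : t + Real.sqrt (t ^ 2 - 4) ≠ 0 := by linarith
    field_simp
    linarith
  have hν' : ν < 0 ∨ 4 * lam < ν := by
    by_contra! h
    exact hν h
  rcases hν' with h | h
  · obtain ⟨w, hw, hwt⟩ := key (2 - ν / lam) (by linarith [div_neg_of_neg_of_pos h hlam])
    refine ⟨w, lt_abs.2 (Or.inl hw), ?_⟩
    have : 2 - w - w⁻¹ = ν / lam := by linarith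
    rw [energy, this]
    field_simp
  · obtain ⟨w, hw, hwt⟩ := key (ν / lam - 2) (by linarith [(lt_div_iff₀ hlam).2 h])
    refine ⟨-w, lt_abs.2 (Or.inr (by linarith)), ?_⟩
    have : 2 - -w - (-w)⁻¹ = ν / lam := by rw [inv_neg]; linarith
    rw [energy, this]
    field_simp

theorem energy_injOn {lam : ℝ} (hlam : 0 < lam) : Set.InjOn (energy lam) (Set.Ioi 1) := by
  intro x hx y hy h
  have hx : 1 < x := hx
  have hy : 1 < y := hy
  have h1 := mul_left_cancel₀ hlam.ne' h
  have h2 : (x - y) * (x * y - 1) = 0 := by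
    field_simp at h1
    linarith
  rcases mul_eq_zero.1 h2 with h3 | h3
  · linarith
  · nlinarith

/-- A solution of `u (n + 2) = (w + w⁻¹) u (n + 1) - u n` with `1 < |w|` that tends to zero is
geometric with ratio `w⁻¹`. -/
theorem decaying_solution {w : ℝ} (hw : 1 < |w|) {u : ℕ → ℂ} (hu : Tendsto u atTop (𝓝 0))
    (hrec : ∀ n, u (n + 2) = ((w : ℂ) + (w : ℂ)⁻¹) * u (n + 1) - u n) (n : ℕ) :
    u (n + 1) = (w : ℂ)⁻¹ * u n := by
  have hw0 : (w : ℂ) ≠ 0 := by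
    rintro h
    norm_num [Complex.ofReal_eq_zero.1 h] at hw
  have hstep : ∀ k, u (n + k + 1) - (w : ℂ)⁻¹ * u (n + k) =
      (w : ℂ) ^ k * (u (n + 1) - (w : ℂ)⁻¹ * u n) := by
    intro k
    induction k with
    | zero => simp
    | succ k ih =>
      rw [pow_succ', mul_assoc, ← ih, ← add_assoc, hrec (n + k)]
      field_simp
      ring
  have hlim : Tendsto (fun k => ‖u (n + k + 1) - (w : ℂ)⁻¹ * u (n + k)‖) atTop (𝓝 0) := by
    have h1 : Tendsto (fun k => u (n + k + 1)) atTop (𝓝 0) :=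
      hu.comp (tendsto_atTop_mono (fun k => by simp only [id]; omega) tendsto_id)
    have h2 : Tendsto (fun k => u (n + k)) atTop (𝓝 0) :=
      hu.comp (tendsto_atTop_mono (fun k => by simp only [id]; omega) tendsto_id)
    simpa using (h1.sub (h2.const_mul (w : ℂ)⁻¹)).norm
  have hle : ‖u (n + 1) - (w : ℂ)⁻¹ * u n‖ ≤ 0 := by
    refine ge_of_tendsto' hlim fun k => ?_
    rw [hstep, norm_mul, norm_pow, Complex.norm_real, Real.norm_eq_abs]
    exact le_mul_of_one_le_left (norm_nonneg _) (one_le_pow₀ hw.le)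
  exact sub_eq_zero.1 (norm_le_zero_iff.1 hle)

/-- An eigenvalue `energy λ w` is characterized by a linear system in `f 0`, `f 1`, `f (-1)`. -/
theorem isEigenvalue_energy_iff_system {lam al de si w : ℝ} (hlam : 0 < lam) (hw : 1 < |w|) :
    IsEigenvalue lam (al * lam) (2 * (si - al) * lam) (de * lam) (energy lam w) ↔
      ∃ A B C : ℂ, ¬(A = 0 ∧ B = 0 ∧ C = 0) ∧
        ((w : ℂ) + de) * B = (al + 1) * A ∧ ((w : ℂ) + de) * C = (al + 1) * A ∧
        ((w : ℂ) + (w : ℂ)⁻¹ + 2 * si) * A = (al + 1) * (B + C) := by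
  have hl : (lam : ℂ) ≠ 0 := Complex.ofReal_ne_zero.2 hlam.ne'
  have hw0 : (w : ℂ) ≠ 0 := by
    rintro h
    norm_num [Complex.ofReal_eq_zero.1 h] at hw
  have hE : ((energy lam w : ℝ) : ℂ) = lam * (2 - w - (w : ℂ)⁻¹) := by
    unfold energy; push_cast; ring
  constructor
  · rintro ⟨f, hf, hsum, heq⟩
    have hlim : Tendsto f cofinite (𝓝 0) := by
      have := hsum.tendsto_cofinite_zero
      have := this.sqrt
      simp only [Real.sqrt_zero, Real.sqrt_sq (norm_nonneg _)] at this
      exact tendsto_zero_iff_norm_tendsto_zero.2 this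
    have hfar : ∀ n : ℤ, n ≠ 0 → n ≠ 1 → n ≠ -1 →
        f (n + 1) + f (n - 1) = ((w : ℂ) + (w : ℂ)⁻¹) * f n := by
      intro n h0 h1 h2
      have := heq n
      simp only [Hop, h0, h1, h2, if_false, hE] at this
      apply mul_left_cancel₀ hl
      linear_combination -this
    have hpos : ∀ n : ℕ, f ((n + 1 : ℕ) + 1 : ℤ) = (w : ℂ)⁻¹ * f ((n : ℤ) + 1) := by
      refine decaying_solution hw (u := fun n : ℕ => f ((n : ℤ) + 1)) ?_ fun n => ?_
      · rw [← Nat.cofinite_eq_atTop]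
        exact hlim.comp (Function.Injective.tendsto_cofinite fun a b h => by simpa using h)
      · have := hfar ((n : ℤ) + 2) (by omega) (by omega) (by omega)
        rw [show (n : ℤ) + 2 + 1 = ((n + 2 : ℕ) : ℤ) + 1 by push_cast; ring,
          show (n : ℤ) + 2 - 1 = (n : ℤ) + 1 by ring,
          show (n : ℤ) + 2 = ((n + 1 : ℕ) : ℤ) + 1 by push_cast; ring] at this
        linear_combination this
    have hneg : ∀ n : ℕ, f (-((n + 1 : ℕ) + 1) : ℤ) = (w : ℂ)⁻¹ * f (-((n : ℤ) + 1)) := by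
      refine decaying_solution hw (u := fun n : ℕ => f (-((n : ℤ) + 1))) ?_ fun n => ?_
      · rw [← Nat.cofinite_eq_atTop]
        exact hlim.comp (Function.Injective.tendsto_cofinite fun a b h => by simpa using h)
      · have := hfar (-((n : ℤ) + 2)) (by omega) (by omega) (by omega)
        rw [show -((n : ℤ) + 2) - 1 = -(((n + 2 : ℕ) : ℤ) + 1) by push_cast; ring,
          show -((n : ℤ) + 2) + 1 = -((n : ℤ) + 1) by ring,
          show -((n : ℤ) + 2) = -(((n + 1 : ℕ) : ℤ) + 1) by push_cast; ring] at this
        linear_combination this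
    refine ⟨f 0, f 1, f (-1), ?_, ?_, ?_, ?_⟩
    · rintro ⟨h0, h1, h2⟩
      have hp : ∀ n : ℕ, f ((n : ℤ) + 1) = 0 := fun n => by
        induction n with
        | zero => simpa using h1
        | succ n ih => rw [hpos, ih, mul_zero]
      have hn : ∀ n : ℕ, f (-((n : ℤ) + 1)) = 0 := fun n => by
        induction n with
        | zero => simpa using h2
        | succ n ih => rw [hneg, ih, mul_zero]
      refine hf (funext fun n => ?_)
      rcases lt_trichotomy n 0 with h | rfl | h
      · obtain ⟨k, hk⟩ := Int.eq_ofNat_of_zero_le (by omega : 0 ≤ -n - 1)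
        rw [show n = -((k : ℤ) + 1) by omega]
        exact hn k
      · exact h0
      · obtain ⟨k, hk⟩ := Int.eq_ofNat_of_zero_le (by omega : 0 ≤ n - 1)
        rw [show n = (k : ℤ) + 1 by omega]
        exact hp k
    · have h := heq 1
      have h2 : f 2 = (w : ℂ)⁻¹ * f 1 := by simpa using hpos 0
      norm_num [Hop, hE, h2] at h
      apply mul_left_cancel₀ hl
      linear_combination h
    · have h := heq (-1)
      have h2 : f (-2) = (w : ℂ)⁻¹ * f (-1) := by simpa using hneg 0
      norm_num [Hop, hE, h2] at h
      apply mul_left_cancel₀ hl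
      linear_combination h
    · have h := heq 0
      norm_num [Hop, hE] at h
      apply mul_left_cancel₀ hl
      linear_combination h
  · rintro ⟨A, B, C, hne, h1, h2, h3⟩
    have hr0 : 0 ≤ |w|⁻¹ ^ 2 := by positivity
    have hr1 : |w|⁻¹ ^ 2 < 1 := pow_lt_one₀ (by positivity) (inv_lt_one_of_one_lt₀ hw) two_ne_zero
    let f : ℤ → ℂ := fun n =>
      if n = 0 then A else if 0 < n then B * (w : ℂ)⁻¹ ^ (n - 1).toNat
      else C * (w : ℂ)⁻¹ ^ (-n - 1).toNat
    have f0 : f 0 = A := by simp [f]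
    have fp : ∀ n : ℕ, f ((n : ℤ) + 1) = B * (w : ℂ)⁻¹ ^ n := fun n => by
      simp only [f]
      rw [if_neg (by omega), if_pos (by omega)]
      simp
    have fn : ∀ n : ℕ, f (-((n : ℤ) + 1)) = C * (w : ℂ)⁻¹ ^ n := fun n => by
      simp only [f]
      rw [if_neg (by omega), if_neg (by omega)]
      simp
    have f1 : f 1 = B := by simpa using fp 0
    have f2 : f 2 = B * (w : ℂ)⁻¹ := by simpa using fp 1
    have g1 : f (-1) = C := by simpa using fn 0
    have g2 : f (-2) = C * (w : ℂ)⁻¹ := by simpa using fn 1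
    have hgeom : ∀ D : ℂ, Summable fun n : ℕ => ‖D * (w : ℂ)⁻¹ ^ n‖ ^ 2 := fun D => by
      refine ((summable_geometric_of_lt_one hr0 hr1).mul_left (‖D‖ ^ 2)).congr fun n => ?_
      rw [norm_mul, norm_pow, norm_inv, Complex.norm_real, Real.norm_eq_abs, mul_pow]
      ring
    refine ⟨f, fun h => hne ⟨?_, ?_, ?_⟩, ?_, fun n => ?_⟩
    · simpa [h] using f0.symm
    · simpa [h] using f1.symm
    · simpa [h] using g1.symm
    · refine Summable.of_nat_of_neg_add_one ((summable_nat_add_iff 1).1 ?_) ?_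
      · refine (hgeom B).congr fun n => ?_
        rw [← fp]
        norm_cast
      · refine (hgeom C).congr fun n => ?_
        rw [← fn]
    · by_cases hn0 : n = 0
      · subst hn0
        norm_num [Hop, hE, f0, f1, g1]
        linear_combination (lam : ℂ) * h3
      by_cases hn1 : n = 1
      · subst hn1
        norm_num [Hop, hE, f0, f1, f2]
        linear_combination (lam : ℂ) * h1
      by_cases hn2 : n = -1
      · subst hn2
        norm_num [Hop, hE, f0, g1, g2]
        linear_combination (lam : ℂ) * h2
      simp only [Hop, hn0, hn1, hn2, if_false, hE]
      rcases lt_or_gt_of_ne hn0 with h | h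
      · obtain ⟨k, hk⟩ := Int.eq_ofNat_of_zero_le (by omega : 0 ≤ -n - 2)
        rw [show n + 1 = -((k : ℤ) + 1) by omega,
          show n - 1 = -(((k + 2 : ℕ) : ℤ) + 1) by push_cast; omega,
          show n = -(((k + 1 : ℕ) : ℤ) + 1) by push_cast; omega, fn, fn, fn]
        linear_combination (lam : ℂ) * C * (w : ℂ)⁻¹ ^ k * mul_inv_cancel₀ hw0
      · obtain ⟨k, hk⟩ := Int.eq_ofNat_of_zero_le (by omega : 0 ≤ n - 2)
        rw [show n - 1 = (k : ℤ) + 1 by omega,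
          show n + 1 = ((k + 2 : ℕ) : ℤ) + 1 by push_cast; omega,
          show n = ((k + 1 : ℕ) : ℤ) + 1 by push_cast; omega, fp, fp, fp]
        linear_combination (lam : ℂ) * B * (w : ℂ)⁻¹ ^ k * mul_inv_cancel₀ hw0

/-- The odd sector contributes `w = -δ`, the even sector the roots of the secular equation. -/
theorem isEigenvalue_energy_iff {lam al de si w : ℝ} (hlam : 0 < lam) (hal : al + 1 ≠ 0)
    (hw : 1 < |w|) :
    IsEigenvalue lam (al * lam) (2 * (si - al) * lam) (de * lam) (energy lam w) ↔
      w = -de ∨ (w + w⁻¹ + 2 * si) * (w + de) = 2 * (al + 1) ^ 2 := by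
  have ha : (al : ℂ) + 1 ≠ 0 := by exact_mod_cast hal
  rw [isEigenvalue_energy_iff_system hlam hw]
  constructor
  · rintro ⟨A, B, C, hne, h1, h2, h3⟩
    by_cases hd : w = -de
    · exact Or.inl hd
    right
    have hwd : (w : ℂ) + de ≠ 0 := by
      intro h
      exact hd (by linarith [(by exact_mod_cast h : w + de = 0)])
    have hA : A ≠ 0 := by
      rintro rfl
      simp only [mul_zero, mul_eq_zero, hwd, false_or] at h1 h2
      exact hne ⟨rfl, h1, h2⟩
    have : ((w : ℂ) + (w : ℂ)⁻¹ + 2 * si) * (w + de) = 2 * (al + 1) ^ 2 := by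
      apply mul_right_cancel₀ hA
      linear_combination ((w : ℂ) + de) * h3 + ((al : ℂ) + 1) * (h1 + h2)
    exact_mod_cast this
  · rintro (rfl | h)
    · exact ⟨0, 1, -1, by simp, by simp, by simp, by simp⟩
    · have h' : ((w : ℂ) + (w : ℂ)⁻¹ + 2 * si) * (w + de) = 2 * (al + 1) ^ 2 := by
        exact_mod_cast h
      refine ⟨(w + de) / (al + 1), 1, 1, by simp, ?_, ?_, ?_⟩
      · field_simp
      · field_simp
      · rw [mul_div_assoc', h']
        field_simp
        ring

theorem mem_discSpec_iff {lam al de si ν : ℝ} (hlam : 0 < lam) (hal : al + 1 ≠ 0) :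
    ν ∈ discSpec lam (al * lam) (2 * (si - al) * lam) (de * lam) ↔
      ∃ w, 1 < |w| ∧ ν = energy lam w ∧
        (w = -de ∨ (w + w⁻¹ + 2 * si) * (w + de) = 2 * (al + 1) ^ 2) := by
  constructor
  · rintro ⟨hev, hν⟩
    obtain ⟨w, hw, rfl⟩ := exists_energy_eq hlam hν
    exact ⟨w, hw, rfl, (isEigenvalue_energy_iff hlam hal hw).1 hev⟩
  · rintro ⟨w, hw, rfl, h⟩
    exact ⟨(isEigenvalue_energy_iff hlam hal hw).2 h, energy_notMem_Icc hlam hw⟩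

/-- Theorem 1 f): in the region `U(+,-)`, if `|δ| ≤ 1` the discrete spectrum is a single
eigenvalue `ν₁ ∈ (-∞, 0)`; if `|δ| > 1` it consists of exactly two distinct eigenvalues
`ν₁ ∈ (-∞, 0)` and `ν₂ = κ`. -/
theorem stmt5 (lam lam1 mu mu1 al de si c1 c2 kap : ℝ)
    (hlam : 0 < lam)
    (hal : al = lam1 / lam) (hde : de = mu1 / lam) (hsi : si = (2 * lam1 + mu) / (2 * lam))
    (hc1 : c1 = (de - 1) * (si - 1) - (al + 1) ^ 2)
    (hc2 : c2 = (de + 1) * (si + 1) - (al + 1) ^ 2)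
    (hkap : kap = (mu1 + lam) ^ 2 / mu1)
    (halne : al ≠ -1)
    (hreg : (0 ≤ c1 ∧ c2 < 0) ∨ (0 < c1 ∧ c2 = 0 ∧ de < -1 ∧ si < -1)) :
    (|de| ≤ 1 →
      ∃ ν1 : ℝ, ν1 < 0 ∧ discSpec lam lam1 mu mu1 = {ν1}) ∧
    (1 < |de| →
      ∃ ν1 ν2 : ℝ, ν1 < 0 ∧ ν2 = kap ∧ ν1 ≠ ν2 ∧
        discSpec lam lam1 mu mu1 = {ν1, ν2}) := by
  have hl := hlam.ne'
  have ha : al + 1 ≠ 0 := fun h => halne (by linarith)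
  have e1 : lam1 = al * lam := by rw [hal]; field_simp
  have e2 : mu1 = de * lam := by rw [hde]; field_simp
  have e3 : mu = 2 * (si - al) * lam := by rw [hsi, hal]; field_simp; ring
  clear hal hde hsi
  subst hc1 hc2 e1 e2 e3
  obtain ⟨w, hw1, hwd, hw⟩ := exists_unique_secular_root ha hreg
  have hwabs : 1 < |w| := lt_abs.2 (Or.inl hw1)
  refine ⟨fun hd => ⟨energy lam w, energy_neg hlam hw1, ?_⟩,
    fun hd => ⟨energy lam w, kap, energy_neg hlam hw1, rfl, ?_⟩⟩
  · ext ν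
    rw [mem_discSpec_iff hlam ha, Set.mem_singleton_iff]
    constructor
    · rintro ⟨x, hx, rfl, rfl | h⟩
      · rw [abs_neg] at hx
        linarith
      · rw [(hw x hx).1 h]
    · rintro rfl
      exact ⟨w, hwabs, rfl, Or.inr ((hw w hwabs).2 rfl)⟩
  · have hd1 : de < -1 := by
      rcases lt_abs.1 hd with h | h
      · rcases hreg with h' | h' <;> nlinarith [sq_nonneg (al + 1), h'.1, h'.2]
      · linarith
    have hkap' : kap = energy lam (-de) := by
      have : de ≠ 0 := by linarith
      rw [hkap, energy, inv_neg]
      field_simp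
      ring
    rw [hkap']
    refine ⟨fun h => hwd.ne' (energy_injOn hlam hw1 (by simpa using by linarith) h), ?_⟩
    ext ν
    rw [mem_discSpec_iff hlam ha, Set.mem_insert_iff, Set.mem_singleton_iff]
    constructor
    · rintro ⟨x, hx, rfl, rfl | h⟩
      · exact Or.inr rfl
      · rw [(hw x hx).1 h]
        exact Or.inl rfl
    · rintro (rfl | rfl)
      · exact ⟨w, hwabs, rfl, Or.inr ((hw w hwabs).2 rfl)⟩
      · exact ⟨-de, by rwa [abs_neg], rfl, Or.inl rfl⟩
end

section
/- Let λ > 0 and λ₁, μ, μ₁ ∈ ℝ with λ₁ = -λ (i.e., α = -1). If |δ| > 1, |σ| > 1 and μ ≠ κ, then the discrete spectrum satisfies s_d(H) = {μ, κ}. -/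
open Filter Topology

/-- The conserved quadratic form of `g (n + 2) = t * g (n + 1) - g n` vanishes on null solutions. -/
theorem quadratic_form_eq_zero_of_tendsto_zero {t : ℂ} {g : ℕ → ℂ}
    (hg : ∀ n, g (n + 2) = t * g (n + 1) - g n) (h0 : Tendsto g atTop (𝓝 0)) :
    g 1 ^ 2 - t * g 1 * g 0 + g 0 ^ 2 = 0 := by
  have hconst : ∀ n, g (n + 1) ^ 2 - t * g (n + 1) * g n + g n ^ 2
      = g 1 ^ 2 - t * g 1 * g 0 + g 0 ^ 2 := by
    intro n
    induction n with
    | zero => rfl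
    | succ k ih => rw [← ih, hg k]; ring
  have h1 : Tendsto (fun n => g (n + 1)) atTop (𝓝 0) := h0.comp (tendsto_add_atTop_nat 1)
  have h2 : Tendsto (fun n => g (n + 1) ^ 2 - t * g (n + 1) * g n + g n ^ 2) atTop (𝓝 0) := by
    simpa using ((h1.pow 2).sub ((h1.const_mul t).mul h0)).add (h0.pow 2)
  simp only [hconst] at h2
  exact tendsto_nhds_unique tendsto_const_nhds h2

/-- A null solution of the half-line problem with boundary coupling `d` is zero unless
`d ^ 2 + t * d + 1 = 0`. -/
theorem eq_zero_or_of_half_line {t d : ℂ} {g : ℕ → ℂ} (h1 : g 1 = (t + d) * g 0)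
    (hg : ∀ n, g (n + 2) = t * g (n + 1) - g n) (h0 : Tendsto g atTop (𝓝 0)) :
    (∀ n, g n = 0) ∨ d ^ 2 + t * d + 1 = 0 := by
  have hq := quadratic_form_eq_zero_of_tendsto_zero hg h0
  rw [h1] at hq
  have hq' : (d ^ 2 + t * d + 1) * g 0 ^ 2 = 0 := by linear_combination hq
  rcases mul_eq_zero.1 hq' with h | h
  · exact Or.inr h
  · have hz : g 0 = 0 := by simpa using h
    have hboth : ∀ n, g n = 0 ∧ g (n + 1) = 0 := by
      intro n
      induction n with
      | zero => exact ⟨hz, by simp [h1, hz]⟩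
      | succ k ih => exact ⟨ih.2, by rw [hg k, ih.1, ih.2]; ring⟩
    exact Or.inl fun n => (hboth n).1

theorem notMem_Icc_of_one_lt_abs {lam mu : ℝ} (hlam : 0 < lam)
    (h : 1 < |(2 * -lam + mu) / (2 * lam)|) : mu ∉ Set.Icc 0 (4 * lam) := by
  rintro ⟨h0, h4⟩
  rw [abs_div, abs_of_pos (by positivity : 0 < 2 * lam), one_lt_div (by positivity)] at h
  exact absurd h (not_lt.2 (abs_le.2 ⟨by linarith, by linarith⟩))

theorem sq_add_div_notMem_Icc {lam mu1 : ℝ} (hlam : 0 < lam) (h : 1 < |mu1 / lam|) :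
    (mu1 + lam) ^ 2 / mu1 ∉ Set.Icc 0 (4 * lam) := by
  rw [abs_div, abs_of_pos hlam, one_lt_div hlam] at h
  rintro ⟨h0, h4⟩
  rcases lt_abs.1 h with h | h
  · have hm : 0 < mu1 := hlam.trans h
    rw [div_le_iff₀ hm] at h4
    nlinarith [sq_pos_of_pos (sub_pos.2 h)]
  · have hm : mu1 < 0 := by linarith
    exact absurd h0 (not_le.2 (div_neg_of_pos_of_neg (by nlinarith) hm))

theorem isEigenvalue_site (lam mu mu1 : ℝ) : IsEigenvalue lam (-lam) mu mu1 mu := by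
  refine ⟨Pi.single 0 1, by simp, ?_, fun n => ?_⟩
  · refine summable_of_ne_finset_zero (s := {0}) fun n hn => ?_
    simp [Finset.mem_singleton.not.1 hn]
  · unfold Hop
    split_ifs with h0 h1 h2
    · simp [h0]
    · simp [h1]
    · simp [h2]
    · have h3 : n + 1 ≠ 0 := by omega
      have h4 : n - 1 ≠ 0 := by omega
      simp [h0, h3, h4]

theorem isEigenvalue_edge {lam mu mu1 : ℝ} (hlam : 0 < lam) (h : 1 < |mu1 / lam|) :
    IsEigenvalue lam (-lam) mu mu1 ((mu1 + lam) ^ 2 / mu1) := by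
  have hm : mu1 ≠ 0 := by rintro rfl; norm_num at h
  have hlc : (lam : ℂ) ≠ 0 := by exact_mod_cast hlam.ne'
  have hmc : (mu1 : ℂ) ≠ 0 := by exact_mod_cast hm
  have hq : ‖-(lam / mu1 : ℂ)‖ < 1 := by
    rw [abs_div, abs_of_pos hlam, one_lt_div hlam] at h
    rw [norm_neg, norm_div, Complex.norm_real, Complex.norm_real, Real.norm_eq_abs,
      Real.norm_eq_abs, abs_of_pos hlam, div_lt_one (abs_pos.2 hm)]
    exact h
  have hqr : (mu1 : ℂ) * -(lam / mu1 : ℂ) = -lam := by field_simp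
  have hval : (((mu1 + lam) ^ 2 / mu1 : ℝ) : ℂ) = mu1 + 2 * lam - lam * -(lam / mu1 : ℂ) := by
    push_cast
    field_simp
    ring
  rw [IsEigenvalue, hval]
  generalize -(lam / mu1 : ℂ) = q at hq hqr
  have hq0 : q ≠ 0 := by rintro rfl; simp [hlc] at hqr
  let f : ℤ → ℂ := fun n => if 0 < n then q ^ n.toNat else 0
  have hpos : ∀ k : ℕ, f (k + 1) = q ^ (k + 1) := fun k => by
    have h1 : (0 : ℤ) < k + 1 := by omega
    have h2 : ((k : ℤ) + 1).toNat = k + 1 := by omega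
    simp only [f, if_pos h1, h2]
  have hneg : ∀ n : ℤ, n ≤ 0 → f n = 0 := fun n hn => if_neg (not_lt.2 hn)
  have hf1 : f 1 = q := by simpa using hpos 0
  have hf2 : f 2 = q ^ 2 := by simpa using hpos 1
  refine ⟨f, fun hf => hq0 (by rw [← hf1, hf]; rfl), ?_, fun n => ?_⟩
  · refine Summable.of_nat_of_neg ?_ ?_
    · rw [← summable_nat_add_iff 1]
      have hs : Summable fun k : ℕ => (‖q‖ ^ 2) ^ (k + 1) :=
        (summable_nat_add_iff 1).2 (summable_geometric_of_lt_one (by positivity)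
          (pow_lt_one₀ (norm_nonneg q) hq two_ne_zero))
      refine hs.congr fun k => ?_
      push_cast
      rw [hpos, norm_pow]
      ring
    · refine summable_zero.congr fun k => ?_
      rw [hneg _ (by omega)]
      simp
  · unfold Hop
    split_ifs with h0 h1 h2
    · simp [h0, hneg 0]
    · rw [h1, hf1, hf2, hneg 0 le_rfl]
      push_cast
      ring
    · simp [h2, hneg]
    · rcases lt_or_ge n 0 with hn | hn
      · simp [hneg n hn.le, hneg (n + 1) (by omega), hneg (n - 1) (by omega)]
      · obtain ⟨k, rfl⟩ : ∃ k : ℕ, n = (k : ℤ) + 1 + 1 := ⟨(n - 2).toNat, by omega⟩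
        have e1 := hpos k
        have e2 := hpos (k + 1)
        have e3 := hpos (k + 1 + 1)
        push_cast at e2 e3
        rw [add_sub_cancel_right, e1, e2, e3]
        linear_combination -q ^ (k + 1) * hqr

theorem eq_of_isEigenvalue {lam mu mu1 ν : ℝ} (hlam : 0 < lam) (hm : mu1 ≠ 0)
    (h : IsEigenvalue lam (-lam) mu mu1 ν) : ν = mu ∨ ν = (mu1 + lam) ^ 2 / mu1 := by
  obtain ⟨f, hf, hs, hH⟩ := h
  have hlc : (lam : ℂ) ≠ 0 := by exact_mod_cast hlam.ne'
  by_cases hν : ν = mu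
  · exact Or.inl hν
  right
  have hf0 : f 0 = 0 := by
    have h0 := hH 0
    simp only [Hop, if_true] at h0
    push_cast at h0
    have : ((ν : ℂ) - mu) * f 0 = 0 := by linear_combination -h0
    refine (mul_eq_zero.1 this).resolve_left (sub_ne_zero.2 ?_)
    exact_mod_cast hν
  have hlim : ∀ e : ℕ → ℤ, Function.Injective e → Tendsto (fun n => f (e n)) atTop (𝓝 0) := by
    intro e he
    have h2 := (hs.comp_injective he).tendsto_atTop_zero
    have h3 := h2.sqrt
    simp only [Function.comp_def, Real.sqrt_zero, Real.sqrt_sq (norm_nonneg _)] at h3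
    exact tendsto_zero_iff_norm_tendsto_zero.2 h3
  have hbulk : ∀ n : ℤ, n ≠ 0 → n ≠ 1 → n ≠ -1 →
      f (n + 1) + f (n - 1) = (2 - ν / lam) * f n := by
    intro n h0 h1 h2
    have h := hH n
    simp only [Hop, h0, h1, h2, if_false] at h
    field_simp
    linear_combination -h
  have hright := eq_zero_or_of_half_line (t := 2 - ν / lam) (d := mu1 / lam)
    (g := fun n : ℕ => f (n + 1))
    (by
      have h := hH 1
      simp [Hop] at h
      norm_num
      field_simp
      linear_combination -h)
    (fun n => by
      have h := hbulk (n + 1 + 1) (by omega) (by omega) (by omega)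
      rw [add_sub_cancel_right] at h
      push_cast
      rw [show (n : ℤ) + 2 + 1 = n + 1 + 1 + 1 by ring]
      linear_combination h)
    (hlim _ fun a b hab => by simpa using hab)
  have hleft := eq_zero_or_of_half_line (t := 2 - ν / lam) (d := mu1 / lam)
    (g := fun n : ℕ => f (-(n + 1)))
    (by
      have h := hH (-1)
      simp [Hop] at h
      norm_num
      field_simp
      linear_combination -h)
    (fun n => by
      have h := hbulk (-(n + 1 + 1)) (by omega) (by omega) (by omega)
      push_cast
      rw [show -((n : ℤ) + 1 + 1) + 1 = -(n + 1) by ring,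
        show -((n : ℤ) + 1 + 1) - 1 = -(n + 2 + 1) by ring] at h
      linear_combination h)
    (hlim _ fun a b hab => by simpa using hab)
  have hroot : (mu1 / lam : ℂ) ^ 2 + (2 - ν / lam) * (mu1 / lam) + 1 = 0 := by
    rcases hright with hr | hr
    · rcases hleft with hl | hl
      · refine absurd (funext fun n => ?_) hf
        rcases lt_trichotomy n 0 with hn | rfl | hn
        · obtain ⟨k, rfl⟩ : ∃ k : ℕ, n = -((k : ℤ) + 1) := ⟨(-n - 1).toNat, by omega⟩
          exact hl k
        · exact hf0
        · obtain ⟨k, rfl⟩ : ∃ k : ℕ, n = (k : ℤ) + 1 := ⟨(n - 1).toNat, by omega⟩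
          exact hr k
      · exact hl
    · exact hr
  have hroot' : (mu1 / lam) ^ 2 + (2 - ν / lam) * (mu1 / lam) + 1 = 0 := by exact_mod_cast hroot
  field_simp at hroot'
  rw [eq_div_iff hm]
  linear_combination -hroot'

/-- Theorem 2, first item: for `λ₁ = -λ`, if `|δ| > 1`, `|σ| > 1` and `μ ≠ κ`,
then `s_d(H) = {μ, κ}`. -/
theorem stmt7 (lam lam1 mu mu1 de si kap : ℝ)
    (hlam : 0 < lam)
    (hlam1 : lam1 = -lam)
    (hde : de = mu1 / lam) (hsi : si = (2 * lam1 + mu) / (2 * lam))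
    (hkap : kap = (mu1 + lam) ^ 2 / mu1)
    (h1 : 1 < |de|) (h2 : 1 < |si|) (h3 : mu ≠ kap) :
    discSpec lam lam1 mu mu1 = {mu, kap} := by
  subst hlam1 hde hsi hkap
  have hm : mu1 ≠ 0 := by rintro rfl; norm_num at h1
  ext ν
  simp only [discSpec, Set.mem_ofPred_eq, Set.mem_insert_iff, Set.mem_singleton_iff]
  constructor
  · exact fun h => eq_of_isEigenvalue hlam hm h.1
  · rintro (rfl | rfl)
    · exact ⟨isEigenvalue_site lam ν mu1, notMem_Icc_of_one_lt_abs hlam h2⟩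
    · exact ⟨isEigenvalue_edge hlam h1, sq_add_div_notMem_Icc hlam h1⟩
end

section
/- Let λ > 0 and λ₁, μ, μ₁ ∈ ℝ with λ₁ = -λ (i.e., α = -1). If |δ| > 1 and |σ| ≤ 1, then the discrete spectrum satisfies s_d(H) = {κ}. -/
open Filter Topology in
/-- A solution of `g (k + 2) = t g (k + 1) - g k` tending to zero annihilates the conserved
quadratic form `g (k + 1) ^ 2 - t g (k + 1) g k + g k ^ 2`. -/
theorem quadratic_eq_zero_of_tendsto_zero {g : ℕ → ℂ} {t : ℂ} (hg : Tendsto g atTop (𝓝 0))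
    (hrec : ∀ k, g (k + 2) = t * g (k + 1) - g k) :
    g 1 ^ 2 - t * g 1 * g 0 + g 0 ^ 2 = 0 := by
  have hconst : ∀ k, g (k + 1) ^ 2 - t * g (k + 1) * g k + g k ^ 2
      = g 1 ^ 2 - t * g 1 * g 0 + g 0 ^ 2 := by
    intro k
    induction k with
    | zero => simp
    | succ k ih =>
      rw [← ih, hrec k]
      ring
  have hg' : Tendsto (fun k => g (k + 1)) atTop (𝓝 0) := hg.comp (tendsto_add_atTop_nat 1)
  have hlim := ((hg'.pow 2).sub ((hg'.const_mul t).mul hg)).add (hg.pow 2)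
  simp only [hconst] at hlim
  simpa using tendsto_nhds_unique tendsto_const_nhds hlim

open Filter Topology in
/-- A nonzero decaying solution of the half-line recursion with boundary condition
`g 1 = (t + d) g 0` forces the secular equation. -/
theorem secular_eq_zero_of_tendsto_zero {g : ℕ → ℂ} {t d : ℂ} (hg : Tendsto g atTop (𝓝 0))
    (hrec : ∀ k, g (k + 2) = t * g (k + 1) - g k) (hbdry : g 1 = (t + d) * g 0)
    (hne : ∃ k, g k ≠ 0) : t * d + d ^ 2 + 1 = 0 := by
  have h0 : g 0 ≠ 0 := by
    intro h0
    have hzero : ∀ k, g k = 0 ∧ g (k + 1) = 0 := by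
      intro k
      induction k with
      | zero => simp [hbdry, h0]
      | succ k ih => simp [hrec, ih.1, ih.2]
    obtain ⟨k, hk⟩ := hne
    exact hk (hzero k).1
  have hq := quadratic_eq_zero_of_tendsto_zero hg hrec
  rw [hbdry] at hq
  have hfac : (t * d + d ^ 2 + 1) * g 0 ^ 2 = 0 := by linear_combination hq
  simpa [h0] using hfac

/-- For `λ₁ = -λ` the origin decouples, so every eigenvalue is `μ` or `κ`. -/
theorem IsEigenvalue.eq_or_eq {lam mu mu1 ν : ℝ} (hlam : lam ≠ 0) (hmu1 : mu1 ≠ 0)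
    (h : IsEigenvalue lam (-lam) mu mu1 ν) : ν = mu ∨ ν = (mu1 + lam) ^ 2 / mu1 := by
  obtain ⟨f, hf, hsum, heq⟩ := h
  rw [or_iff_not_imp_left]
  intro hν
  have hlamC : (lam : ℂ) ≠ 0 := by exact_mod_cast hlam
  have hf0 : f 0 = 0 := by
    have h0 := heq 0
    simp only [Hop, if_true] at h0
    push_cast at h0
    have hfac : ((ν : ℂ) - mu) * f 0 = 0 := by linear_combination -h0
    refine (mul_eq_zero.1 hfac).resolve_left fun h => hν ?_
    exact_mod_cast sub_eq_zero.1 h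
  have hdecay : Filter.Tendsto f Filter.cofinite (nhds 0) := by
    rw [tendsto_zero_iff_norm_tendsto_zero]
    simpa using hsum.tendsto_cofinite_zero.sqrt
  have hside : ∃ s : ℤ, (s = 1 ∨ s = -1) ∧ ∃ k : ℕ, f (s * (k + 1)) ≠ 0 := by
    obtain ⟨n, hn⟩ := Function.ne_iff.1 hf
    rcases lt_trichotomy n 0 with h | h | h
    · exact ⟨-1, Or.inr rfl, (-n - 1).toNat, by
        rwa [show (-1 : ℤ) * (((-n - 1).toNat : ℤ) + 1) = n by omega]⟩
    · exact absurd (h ▸ hf0) hn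
    · exact ⟨1, Or.inl rfl, (n - 1).toNat, by
        rwa [show (1 : ℤ) * (((n - 1).toNat : ℤ) + 1) = n by omega]⟩
  obtain ⟨s, hs, hne⟩ := hside
  have hinj : Function.Injective fun k : ℕ => s * ((k : ℤ) + 1) := by
    intro a b hab
    rcases hs with rfl | rfl <;> simpa using hab
  have hg : Filter.Tendsto (fun k : ℕ => f (s * (k + 1))) Filter.atTop (nhds 0) := by
    rw [← Nat.cofinite_eq_atTop]
    exact hdecay.comp hinj.tendsto_cofinite
  have hsec := secular_eq_zero_of_tendsto_zero (t := 2 - ν / lam) (d := mu1 / lam) hg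
    (by
      intro k
      have hk := heq (s * (k + 2))
      rw [Hop, if_neg (by rcases hs with rfl | rfl <;> omega),
        if_neg (by rcases hs with rfl | rfl <;> omega),
        if_neg (by rcases hs with rfl | rfl <;> omega)] at hk
      rcases hs with rfl | rfl
      · rw [show (1 : ℤ) * (k + 2) + 1 = 1 * (k + 2 + 1) by ring,
          show (1 : ℤ) * (k + 2) - 1 = 1 * (k + 1) by ring,
          show (1 : ℤ) * (k + 2) = 1 * (k + 1 + 1) by ring] at hk
        push_cast
        field_simp
        linear_combination -hk
      · rw [show (-1 : ℤ) * (k + 2) + 1 = -1 * (k + 1) by ring,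
          show (-1 : ℤ) * (k + 2) - 1 = -1 * (k + 2 + 1) by ring,
          show (-1 : ℤ) * (k + 2) = -1 * (k + 1 + 1) by ring] at hk
        push_cast
        field_simp
        linear_combination -hk)
    (by
      have hk := heq s
      rcases hs with rfl | rfl <;> simp [Hop, hf0] at hk ⊢ <;> field_simp <;>
        linear_combination -hk)
    hne
  have hsecR : (2 - ν / lam) * (mu1 / lam) + (mu1 / lam) ^ 2 + 1 = 0 := by exact_mod_cast hsec
  field_simp at hsecR ⊢
  linarith

/-- For `λ₁ = -λ` and `|μ₁| > λ`, the geometric sequence with ratio `-λ / μ₁` on the positive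
half-line is an eigenvector with eigenvalue `κ`. -/
theorem isEigenvalue_kappa {lam mu mu1 : ℝ} (hlam : 0 < lam) (h : lam < |mu1|) :
    IsEigenvalue lam (-lam) mu mu1 ((mu1 + lam) ^ 2 / mu1) := by
  have hmu1 : mu1 ≠ 0 := abs_pos.1 (hlam.trans h)
  have hmu1C : (mu1 : ℂ) ≠ 0 := by exact_mod_cast hmu1
  have hlamC : (lam : ℂ) ≠ 0 := by exact_mod_cast hlam.ne'
  obtain ⟨z, hz⟩ : ∃ z : ℂ, z = -lam / mu1 := ⟨_, rfl⟩
  have hz1 : ‖z‖ < 1 := by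
    rw [hz, norm_div, norm_neg, Complex.norm_real, Complex.norm_real, Real.norm_eq_abs,
      Real.norm_eq_abs, abs_of_pos hlam]
    exact (div_lt_one (hlam.trans h)).2 h
  have hz0 : z ≠ 0 := hz ▸ div_ne_zero (neg_ne_zero.2 hlamC) hmu1C
  have hzmul : (mu1 : ℂ) * z = -lam := by rw [hz]; field_simp
  refine ⟨fun n => if 1 ≤ n then z ^ n.toNat else 0, fun hf => hz0 ?_, ?_, fun n => ?_⟩
  · simpa using congrFun hf 1
  · refine Summable.of_nat_of_neg ?_ ?_
    · refine Summable.of_nonneg_of_le (fun _ => by positivity) (fun n => ?_)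
        (summable_geometric_of_lt_one (norm_nonneg z) hz1)
      dsimp only
      split_ifs
      · rw [Int.toNat_natCast, norm_pow, ← pow_mul]
        exact pow_le_pow_of_le_one (norm_nonneg z) hz1.le (by omega)
      · simp
    · refine summable_zero.congr fun n => ?_
      simp [show ¬ (1 : ℤ) ≤ -n by omega]
  · rcases lt_or_ge n 2 with hn | hn
    · rcases lt_or_ge n 1 with hn1 | hn1
      · by_cases h0 : n = 0
        · subst h0
          simp [Hop]
        · by_cases hm : n = -1
          · subst hm
            simp [Hop]
          · simp [Hop, h0, hm, show n ≠ 1 by omega, show ¬ 1 ≤ n by omega,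
              show ¬ 1 ≤ n + 1 by omega, show ¬ 1 ≤ n - 1 by omega]
      · obtain rfl : n = 1 := by omega
        simp [Hop]
        rw [div_mul_eq_mul_div, eq_div_iff hmu1C]
        linear_combination (-lam * z) * hzmul
    · obtain ⟨k, rfl⟩ : ∃ k : ℕ, n = k + 2 := ⟨(n - 2).toNat, by omega⟩
      have e1 : ((k : ℤ) + 2 + 1).toNat = k + 3 := by omega
      have e2 : ((k : ℤ) + 2 - 1).toNat = k + 1 := by omega
      have e3 : ((k : ℤ) + 2).toNat = k + 2 := by omega
      rw [Hop, if_neg (by omega), if_neg (by omega), if_neg (by omega)]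
      simp only [show (1 : ℤ) ≤ k + 2 + 1 by omega, show (1 : ℤ) ≤ k + 2 - 1 by omega,
        show (1 : ℤ) ≤ k + 2 by omega, if_true, e1, e2, e3]
      push_cast
      rw [div_mul_eq_mul_div, eq_div_iff hmu1C]
      linear_combination (-(lam * z + mu1) * z ^ (k + 1)) * hzmul

/-- `(μ₁ + λ)² / μ₁` avoids the band `[0, 4λ]` when `|μ₁| > λ`. -/
theorem kappa_notMem_Icc {lam mu1 : ℝ} (hlam : 0 < lam) (h : lam < |mu1|) :
    (mu1 + lam) ^ 2 / mu1 ∉ Set.Icc 0 (4 * lam) := by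
  rintro ⟨hlo, hhi⟩
  rcases lt_abs.1 h with hpos | hneg
  · rw [div_le_iff₀ (hlam.trans hpos)] at hhi
    nlinarith [sq_pos_of_pos (sub_pos.2 hpos)]
  · have hlt : (mu1 + lam) ^ 2 / mu1 < 0 :=
      div_neg_of_pos_of_neg (sq_pos_of_neg (by linarith)) (by linarith)
    linarith

/-- Theorem 2, third item: for `λ₁ = -λ`, if `|δ| > 1` and `|σ| ≤ 1`, then `s_d(H) = {κ}`. -/
theorem stmt9 (lam lam1 mu mu1 de si kap : ℝ)
    (hlam : 0 < lam)
    (hlam1 : lam1 = -lam)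
    (hde : de = mu1 / lam) (hsi : si = (2 * lam1 + mu) / (2 * lam))
    (hkap : kap = (mu1 + lam) ^ 2 / mu1)
    (h1 : 1 < |de|) (h2 : |si| ≤ 1) :
    discSpec lam lam1 mu mu1 = {kap} := by
  subst hlam1 hkap
  have hmu1 : lam < |mu1| := by
    rwa [hde, abs_div, abs_of_pos hlam, one_lt_div hlam] at h1
  have hmu : mu ∈ Set.Icc 0 (4 * lam) := by
    rw [hsi, abs_le, le_div_iff₀ (by positivity), div_le_iff₀ (by positivity)] at h2
    constructor <;> linarith [h2.1, h2.2]
  ext ν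
  refine ⟨fun ⟨hν, hout⟩ => ?_, ?_⟩
  · refine (hν.eq_or_eq hlam.ne' (abs_pos.1 (hlam.trans hmu1))).resolve_left ?_
    rintro rfl
    exact hout hmu
  · rintro rfl
    exact ⟨isEigenvalue_kappa hlam hmu1, kappa_notMem_Icc hlam hmu1⟩
end

section
/- Let λ > 0 and λ₁, μ, μ₁ ∈ ℝ with λ₁ = -λ (i.e., α = -1). If |δ| ≤ 1 and |σ| ≤ 1, then the discrete spectrum s_d(H) is empty: no real ν ∉ [0, 4λ] is an eigenvalue of H. -/
/-- A null sequence solving `l (g (n + 2) + g n) = a g (n + 1)` with `2 l < |a|` and boundary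
condition `l g 1 = (a + m) g 0`, `|m| ≤ l`, vanishes, because its modulus is monotone. -/
theorem eq_zero_of_recurrence {l a m : ℝ} (hl : 0 < l) (ha : 2 * l < |a|) (hm : |m| ≤ l)
    {g : ℕ → ℂ} (hg : Filter.Tendsto g Filter.atTop (nhds 0))
    (hone : (l : ℂ) * g 1 = ((a + m : ℝ) : ℂ) * g 0)
    (hrec : ∀ n, (l : ℂ) * (g (n + 2) + g n) = (a : ℂ) * g (n + 1)) (n : ℕ) : g n = 0 := by
  have hmono : Monotone fun n => ‖g n‖ := by
    refine monotone_nat_of_le_succ fun n => ?_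
    induction n with
    | zero =>
      have h := congrArg norm hone
      rw [norm_mul, norm_mul, Complex.norm_real, Complex.norm_real, Real.norm_eq_abs,
        Real.norm_eq_abs, abs_of_pos hl] at h
      have ham : l ≤ |a + m| := by
        have := abs_sub_abs_le_abs_sub a (-m)
        rw [abs_neg, sub_neg_eq_add] at this
        linarith
      refine le_of_mul_le_mul_left ?_ hl
      rw [zero_add, h]
      exact mul_le_mul_of_nonneg_right ham (norm_nonneg _)
    | succ k ih =>
      have h := congrArg norm (hrec k)
      rw [norm_mul, norm_mul, Complex.norm_real, Complex.norm_real, Real.norm_eq_abs,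
        Real.norm_eq_abs, abs_of_pos hl] at h
      have htri := mul_le_mul_of_nonneg_left (norm_add_le (g (k + 2)) (g k)) hl.le
      have hlow := mul_le_mul_of_nonneg_right ha.le (norm_nonneg (g (k + 1)))
      have hstep := mul_le_mul_of_nonneg_left ih hl.le
      refine le_of_mul_le_mul_left ?_ hl
      change l * ‖g (k + 1)‖ ≤ l * ‖g (k + 2)‖
      linarith
  have hlim : Filter.Tendsto (fun n => ‖g n‖) Filter.atTop (nhds 0) := by simpa using hg.norm
  exact norm_le_zero_iff.mp (hmono.ge_of_tendsto hlim n)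

/-- A square-summable sequence on `ℤ` tends to zero along every injective sequence of indices. -/
theorem tendsto_zero_of_summable_norm_sq {f : ℤ → ℂ} (hf : Summable fun n => ‖f n‖ ^ 2)
    {e : ℕ → ℤ} (he : Function.Injective e) :
    Filter.Tendsto (fun n => f (e n)) Filter.atTop (nhds 0) := by
  have h := (hf.comp_injective he).tendsto_atTop_zero.sqrt
  rw [tendsto_zero_iff_norm_tendsto_zero]
  simpa [Function.comp_def, Real.sqrt_sq (norm_nonneg _)] using h

/-- Theorem 2, fourth item: for `λ₁ = -λ`, if `|δ| ≤ 1` and `|σ| ≤ 1`, then `s_d(H) = ∅`. -/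
theorem stmt10 (lam lam1 mu mu1 de si : ℝ)
    (hlam : 0 < lam)
    (hlam1 : lam1 = -lam)
    (hde : de = mu1 / lam) (hsi : si = (2 * lam1 + mu) / (2 * lam))
    (h1 : |de| ≤ 1) (h2 : |si| ≤ 1) :
    discSpec lam lam1 mu mu1 = ∅ := by
  subst hlam1
  have hmu1 : |mu1| ≤ lam := by
    rwa [hde, abs_div, abs_of_pos hlam, div_le_one hlam] at h1
  have hmu : |2 * -lam + mu| ≤ 2 * lam := by
    have h2lam : 0 < 2 * lam := by positivity
    rwa [hsi, abs_div, abs_of_pos h2lam, div_le_one h2lam] at h2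
  rw [abs_le] at hmu
  refine Set.eq_empty_iff_forall_notMem.mpr ?_
  rintro ν ⟨⟨f, hne, hsum, heq⟩, hν⟩
  have hf0 : f 0 = 0 := by
    have h := heq 0
    simp only [Hop, if_true] at h
    push_cast at h
    have hprod : ((mu : ℂ) - ν) * f 0 = 0 := by linear_combination h
    refine (mul_eq_zero.mp hprod).resolve_left fun h0 => hν ?_
    have hmuν : mu = ν := by exact_mod_cast sub_eq_zero.mp h0
    exact ⟨by linarith, by linarith⟩
  have ha : 2 * lam < |2 * lam - ν| := by
    by_contra! h
    rw [abs_le] at h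
    exact hν ⟨by linarith, by linarith⟩
  have hpos : ∀ n : ℕ, f (n + 1) = 0 := by
    refine eq_zero_of_recurrence hlam ha hmu1
      (tendsto_zero_of_summable_norm_sq hsum fun i j h => by simpa using h) ?_ fun n => ?_
    · have h := heq 1
      norm_num [Hop] at h ⊢
      linear_combination -h
    · have h := heq (n + 2)
      rw [Hop, if_neg (by lia), if_neg (by lia), if_neg (by lia),
        show (n : ℤ) + 2 + 1 = n + 3 by ring, show (n : ℤ) + 2 - 1 = n + 1 by ring] at h
      push_cast
      rw [show (n : ℤ) + 2 + 1 = n + 3 by ring, show (n : ℤ) + 1 + 1 = n + 2 by ring]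
      linear_combination -h
  have hneg : ∀ n : ℕ, f (-n - 1) = 0 := by
    refine eq_zero_of_recurrence hlam ha hmu1
      (tendsto_zero_of_summable_norm_sq hsum fun i j h => by simpa using h) ?_ fun n => ?_
    · have h := heq (-1)
      norm_num [Hop] at h ⊢
      linear_combination -h
    · have h := heq (-n - 2)
      rw [Hop, if_neg (by lia), if_neg (by lia), if_neg (by lia),
        show -(n : ℤ) - 2 + 1 = -n - 1 by ring, show -(n : ℤ) - 2 - 1 = -n - 3 by ring] at h
      push_cast
      rw [show -((n : ℤ) + 2) - 1 = -n - 3 by ring, show -((n : ℤ) + 1) - 1 = -n - 2 by ring]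
      linear_combination -h
  refine hne (funext fun n => ?_)
  rcases lt_trichotomy n 0 with h | rfl | h
  · obtain ⟨k, rfl⟩ : ∃ k : ℕ, n = -k - 1 := ⟨(-n - 1).toNat, by lia⟩
    exact hneg k
  · exact hf0
  · obtain ⟨k, rfl⟩ : ∃ k : ℕ, n = k + 1 := ⟨(n - 1).toNat, by lia⟩
    exact hpos k
end
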